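/- arXiv:1801.02479 — 7 statements merged into one kernel-verified Lean document; each statement's English description precedes it below -/
import Mathlib

section
/- Ultrametric Gromov-type renormalization lemma: Let R > 0, let B = {x ∈ k : |x| ≤ R} be the closed ball of radius R, and let φ : B → [0,∞) be locally bounded (every point of B has a neighbourhood in B on which φ is bounded). Fix ε > 0 and τ > 1. Then for every a ∈ B with φ(a) > 0 there exists b ∈ B such that: (i) |a − b| ≤ τ/(ε·(τ−1)·φ(a)); (ii) φ(b) ≥ φ(a); (iii) every x ∈ B with |x − b| ≤ 1/(ε·φ(b)) satisfies φ(x) ≤ τ·φ(b). -/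
/-!
Ultrametric Gromov-type renormalization lemma.

`k` is a field complete with respect to a non-trivial non-Archimedean absolute
value; `B = {x : k | ‖x‖ ≤ R}` is the closed ball of radius `R`, and
`φ : B → [0,∞)` is locally bounded. For `ε > 0`, `τ > 1` and `a ∈ B` with
`φ a > 0`, there is `b ∈ B` with:
(i)  `‖a - b‖ ≤ τ / (ε * (τ - 1) * φ a)`;
(ii) `φ a ≤ φ b`;
(iii) every `x ∈ B` with `‖x - b‖ ≤ 1 / (ε * φ b)` satisfies `φ x ≤ τ * φ b`.
-/

theorem gromov_renormalization
    {k : Type*} [NontriviallyNormedField k] [CompleteSpace k]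
    [IsUltrametricDist k]
    (R : ℝ) (hR : 0 < R)
    (φ : k → ℝ)
    (hφ0 : ∀ x ∈ Metric.closedBall (0 : k) R, 0 ≤ φ x)
    (hloc : ∀ x ∈ Metric.closedBall (0 : k) R,
      ∃ M : ℝ, ∀ᶠ y in nhdsWithin x (Metric.closedBall (0 : k) R), φ y ≤ M)
    (ε τ : ℝ) (hε : 0 < ε) (hτ : 1 < τ)
    (a : k) (ha : a ∈ Metric.closedBall (0 : k) R) (hφa : 0 < φ a) :
    ∃ b ∈ Metric.closedBall (0 : k) R,
      ‖a - b‖ ≤ τ / (ε * (τ - 1) * φ a) ∧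
      φ a ≤ φ b ∧
      ∀ x ∈ Metric.closedBall (0 : k) R, ‖x - b‖ ≤ 1 / (ε * φ b) →
        φ x ≤ τ * φ b := by
  by_contra hcon
  have hτ0 : 0 < τ := by linarith
  have hC : 1 / (ε * φ a) ≤ τ / (ε * (τ - 1) * φ a) := by
    have hτ1 : 0 < τ - 1 := by linarith
    rw [div_le_div_iff₀ (by positivity) (by positivity)]
    nlinarith [mul_pos hε hφa]
  let S : Set k := {b | b ∈ Metric.closedBall (0 : k) R ∧ ‖a - b‖ ≤ 1 / (ε * φ a) ∧ φ a ≤ φ b}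
  have step : ∀ b : S, ∃ x : S, ‖(x : k) - b‖ ≤ 1 / (ε * φ b) ∧ τ * φ b < φ x := by
    rintro ⟨b, hbB, hab, hφb⟩
    by_contra hno
    refine hcon ⟨b, hbB, hab.trans hC, hφb, fun x hx hxb => ?_⟩
    by_contra! hlt
    have hxb' : ‖b - x‖ ≤ 1 / (ε * φ a) := by
      rw [norm_sub_rev]
      exact hxb.trans (one_div_le_one_div_of_le (by positivity) (by gcongr))
    refine hno ⟨⟨x, hx, ?_, by nlinarith⟩, hxb, hlt⟩
    rw [← sub_add_sub_cancel a b x]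
    exact (IsUltrametricDist.norm_add_le_max _ _).trans (max_le hab hxb')
  choose f hf_dist hf_growth using step
  let u : ℕ → S := fun n => f^[n] ⟨a, ha, by simpa using by positivity, le_rfl⟩
  have hu_succ (n : ℕ) : u (n + 1) = f (u n) := Function.iterate_succ_apply' f n _
  have hgrowth (n : ℕ) : φ a * τ ^ n ≤ φ (u n) := by
    induction n with
    | zero => simp [u]
    | succ n ih =>
      rw [hu_succ]
      calc φ a * τ ^ (n + 1) = τ * (φ a * τ ^ n) := by ring
        _ ≤ τ * φ (u n) := by gcongr
        _ ≤ φ (f (u n)) := (hf_growth _).le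
  have hcauchy : CauchySeq fun n => (u n : k) := by
    refine cauchySeq_of_le_geometric τ⁻¹ (1 / (ε * φ a)) (inv_lt_one_of_one_lt₀ hτ) fun n => ?_
    rw [dist_comm, dist_eq_norm, hu_succ]
    calc ‖(f (u n) : k) - u n‖ ≤ 1 / (ε * φ (u n)) := hf_dist _
      _ ≤ 1 / (ε * (φ a * τ ^ n)) :=
        one_div_le_one_div_of_le (by positivity) (by gcongr; exact hgrowth n)
      _ = 1 / (ε * φ a) * τ⁻¹ ^ n := by rw [inv_pow]; field_simp
  obtain ⟨l, hl⟩ := cauchySeq_tendsto_of_complete hcauchy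
  have hu_mem (n : ℕ) : (u n : k) ∈ Metric.closedBall (0 : k) R := (u n).2.1
  have hlB := Metric.isClosed_closedBall.mem_of_tendsto hl (Filter.Eventually.of_forall hu_mem)
  obtain ⟨M, hM⟩ := hloc l hlB
  have hbdd := (tendsto_nhdsWithin_iff.2 ⟨hl, Filter.Eventually.of_forall hu_mem⟩).eventually hM
  have htop : Filter.Tendsto (fun n : ℕ => φ a * τ ^ n) Filter.atTop Filter.atTop :=
    (tendsto_pow_atTop_atTop_of_one_lt hτ).const_mul_atTop hφa
  obtain ⟨n, hle, hlt⟩ := (hbdd.and (htop.eventually_gt_atTop M)).exists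
  exact absurd (hlt.trans_le (hgrowth n)) hle.not_gt
end

section
/- Invariance of the Fubini–Study derivative under precomposition with PGL(2, k°): Let a, b, c, d ∈ k with |a|, |b|, |c|, |d| ≤ 1 and |a·d − b·c| = 1. Let z ∈ k with c·z + d ≠ 0 and set w := (a·z + b)/(c·z + d). Let f_0, …, f_N : k → k be differentiable at w with not all f_i(w) = 0, and set h_i(t) := f_i((a·t + b)/(c·t + d)). Then the Fubini–Study derivative of the tuple h = (h_0,…,h_N) at z equals the Fubini–Study derivative of the tuple f = (f_0,…,f_N) at w. -/
/-!
Invariance of the Fubini–Study derivative under precomposition with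
`PGL(2, k°)`.

Let `a, b, c, d ∈ k` with `‖a‖, ‖b‖, ‖c‖, ‖d‖ ≤ 1` and `‖a*d - b*c‖ = 1`.
Let `z ∈ k` with `c*z + d ≠ 0` and `w = (a*z + b)/(c*z + d)`. Let
`f 0, …, f N` be differentiable at `w` (derivatives `f' i`), not all vanishing
at `w`, and let `h' i` be the derivative at `z` of
`h i : t ↦ f i ((a*t + b)/(c*t + d))` (so `h i z = f i w`). Then the
Fubini–Study derivative of the tuple `h` at `z` equals the Fubini–Study
derivative of the tuple `f` at `w`.
-/

/-- A linear form with integral coefficients is bounded by the sup norm. -/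
theorem norm_mul_add_mul_le_max {k : Type*} [NormedField k] [IsUltrametricDist k]
    {p q : k} (hp : ‖p‖ ≤ 1) (hq : ‖q‖ ≤ 1) (x y : k) :
    ‖p * x + q * y‖ ≤ max ‖x‖ ‖y‖ := by
  refine (IsUltrametricDist.norm_add_le_max _ _).trans (max_le_max ?_ ?_)
  · rw [norm_mul]
    exact mul_le_of_le_one_left (norm_nonneg x) hp
  · rw [norm_mul]
    exact mul_le_of_le_one_left (norm_nonneg y) hq

/-- Integral matrices whose determinant is a unit preserve the sup norm on `k²`. -/
theorem max_norm_linear_eq {k : Type*} [NormedField k] [IsUltrametricDist k]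
    {a b c d : k} (ha : ‖a‖ ≤ 1) (hb : ‖b‖ ≤ 1) (hc : ‖c‖ ≤ 1) (hd : ‖d‖ ≤ 1)
    (hdet : ‖a * d - b * c‖ = 1) (x y : k) :
    max ‖a * x + b * y‖ ‖c * x + d * y‖ = max ‖x‖ ‖y‖ := by
  apply le_antisymm
  · exact max_le (norm_mul_add_mul_le_max ha hb x y) (norm_mul_add_mul_le_max hc hd x y)
  · have hx : ‖x‖ = ‖d * (a * x + b * y) + -b * (c * x + d * y)‖ := by
      rw [← one_mul ‖x‖, ← hdet, ← norm_mul]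
      congr 1
      ring
    have hy : ‖y‖ = ‖-c * (a * x + b * y) + a * (c * x + d * y)‖ := by
      rw [← one_mul ‖y‖, ← hdet, ← norm_mul]
      congr 1
      ring
    apply max_le
    · rw [hx]
      exact norm_mul_add_mul_le_max hd (by rwa [norm_neg]) _ _
    · rw [hy]
      exact norm_mul_add_mul_le_max (by rwa [norm_neg]) ha _ _

/-- The transformation rule for `max 1 ‖z‖ ^ 2` under an integral Möbius map. -/
theorem max_one_sq_norm_mobius {k : Type*} [NormedField k] [IsUltrametricDist k]
    {a b c d : k} (ha : ‖a‖ ≤ 1) (hb : ‖b‖ ≤ 1) (hc : ‖c‖ ≤ 1) (hd : ‖d‖ ≤ 1)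
    (hdet : ‖a * d - b * c‖ = 1) {z : k} (hz : c * z + d ≠ 0) :
    max 1 (‖z‖ ^ 2) =
      max 1 (‖(a * z + b) / (c * z + d)‖ ^ 2) * ‖c * z + d‖ ^ 2 := by
  have sq_max : ∀ {r s : ℝ}, 0 ≤ r → 0 ≤ s → max r s ^ 2 = max (r ^ 2) (s ^ 2) :=
    fun hr hs => (pow_left_monotoneOn (n := 2)).map_max hr hs
  have h := max_norm_linear_eq ha hb hc hd hdet z 1
  rw [mul_one, mul_one, norm_one] at h
  have h2 := congrArg (· ^ 2) h
  simp only [sq_max (norm_nonneg _) (norm_nonneg _),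
    sq_max (norm_nonneg _) zero_le_one, one_pow] at h2
  rw [max_comm, ← h2, max_mul_of_nonneg _ _ (sq_nonneg _), one_mul, ← mul_pow, ← norm_mul,
    div_mul_cancel₀ _ hz, max_comm]

/-- The derivative of a Möbius map. -/
theorem hasDerivAt_mobius {k : Type*} [NontriviallyNormedField k]
    (a b : k) {c d z : k} (hz : c * z + d ≠ 0) :
    HasDerivAt (fun t => (a * t + b) / (c * t + d))
      ((a * d - b * c) / (c * z + d) ^ 2) z := by
  have hlin : ∀ p q : k, HasDerivAt (fun t => p * t + q) p z := fun p q => by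
    simpa using ((hasDerivAt_id z).const_mul p).add_const q
  exact ((hlin a b).fun_div (hlin c d) hz).congr_deriv (by ring)

theorem fubiniStudy_deriv_mobius_invariant
    {k : Type*} [NontriviallyNormedField k] [CompleteSpace k]
    [IsUltrametricDist k]
    (N : ℕ) (a b c d : k)
    (ha : ‖a‖ ≤ 1) (hb : ‖b‖ ≤ 1) (hc : ‖c‖ ≤ 1) (hd : ‖d‖ ≤ 1)
    (hdet : ‖a * d - b * c‖ = 1)
    (z w : k) (hz : c * z + d ≠ 0) (hw : w = (a * z + b) / (c * z + d))
    (f : Fin (N + 1) → k → k) (f' : Fin (N + 1) → k)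
    (hdiff : ∀ i, HasDerivAt (f i) (f' i) w)
    (hnz : ∃ i, f i w ≠ 0)
    (h' : Fin (N + 1) → k)
    (hh : ∀ i, HasDerivAt (fun t => f i ((a * t + b) / (c * t + d))) (h' i) z) :
    max 1 (‖z‖ ^ 2) *
        (⨆ p : Fin (N + 1) × Fin (N + 1),
          ‖h' p.1 * f p.2 w - h' p.2 * f p.1 w‖) / (⨆ i, ‖f i w‖) ^ 2
      = max 1 (‖w‖ ^ 2) *
          (⨆ p : Fin (N + 1) × Fin (N + 1),
            ‖f' p.1 * f p.2 w - f' p.2 * f p.1 w‖) / (⨆ i, ‖f i w‖) ^ 2 := by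
  have hder : ∀ i, h' i = f' i * ((a * d - b * c) / (c * z + d) ^ 2) := fun i =>
    (hh i).unique (HasDerivAt.comp z (hw ▸ hdiff i) (hasDerivAt_mobius a b hz))
  have hminor : ∀ p : Fin (N + 1) × Fin (N + 1),
      ‖h' p.1 * f p.2 w - h' p.2 * f p.1 w‖ =
        (‖c * z + d‖ ^ 2)⁻¹ * ‖f' p.1 * f p.2 w - f' p.2 * f p.1 w‖ := fun p => by
    have hfactor : h' p.1 * f p.2 w - h' p.2 * f p.1 w =
        (a * d - b * c) / (c * z + d) ^ 2 * (f' p.1 * f p.2 w - f' p.2 * f p.1 w) := by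
      rw [hder, hder]
      ring
    rw [hfactor, norm_mul, norm_div, hdet, norm_pow, one_div]
  have hne : ‖c * z + d‖ ^ 2 ≠ 0 := pow_ne_zero 2 (norm_ne_zero_iff.mpr hz)
  simp only [hminor]
  rw [← Real.mul_iSup_of_nonneg (by positivity), max_one_sq_norm_mobius ha hb hc hd hdet hz,
    ← hw, mul_assoc, mul_inv_cancel_left₀ hne]
end

section
/- Diameter–derivative identity for analytic functions on a disk (residue characteristic zero): Let r > 0 and let a : ℕ → k satisfy |a_n|·r^n → 0 as n → ∞, so that f(z) := ∑_{n≥0} a_n z^n converges for every z ∈ k with |z| ≤ r, with derivative f'(z) = ∑_{n≥1} n·a_n z^{n−1}. Then sup_{z ∈ k, |z| ≤ r} |f(z) − f(0)| = r · sup_{z ∈ k, |z| ≤ r} |f'(z)|, and both sides equal sup_{n ≥ 1} |a_n|·r^n. -/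
/-!
Diameter–derivative identity for analytic functions on a disk (residue
characteristic zero).

`k` is a complete algebraically closed non-Archimedean field of residue
characteristic zero (`‖m‖ = 1` for every positive integer `m`).  Let `r > 0`
and let `a : ℕ → k` satisfy `‖a n‖ * r ^ n → 0`, so that
`f z = ∑' n, a n * z ^ n` converges on the closed ball of radius `r`, with
derivative `f' z = ∑' n, (n+1) * a (n+1) * z ^ n`.  Then
`sup_{‖z‖ ≤ r} ‖f z - f 0‖ = r * sup_{‖z‖ ≤ r} ‖f' z‖`, and both sides equal
`sup_{n ≥ 1} ‖a n‖ * r ^ n`.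
-/

section PowerSeriesOnBall

variable {k : Type*} [NontriviallyNormedField k]

/-- The norm of an algebraically closed field takes values arbitrarily close below any `r > 0`. -/
lemma exists_lt_norm_le_of_isAlgClosed [IsAlgClosed k] {s r : ℝ} (hs : 0 < s) (hsr : s < r) :
    ∃ c : k, s < ‖c‖ ∧ ‖c‖ ≤ r := by
  have hr : 0 < r := hs.trans hsr
  obtain ⟨x, hx⟩ := NormedField.exists_one_lt_norm k
  obtain ⟨n, hn⟩ := pow_unbounded_of_one_lt ‖x‖ ((one_lt_div hs).2 hsr)
  have hn0 : n ≠ 0 := by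
    rintro rfl
    rw [pow_zero] at hn
    exact hn.not_gt hx
  obtain ⟨q, hq⟩ := IsAlgClosed.exists_pow_nat_eq x (Nat.pos_of_ne_zero hn0)
  have hqx : ‖q‖ ^ n = ‖x‖ := by rw [← norm_pow, hq]
  have hq1 : 1 < ‖q‖ := by
    by_contra! h
    exact hx.not_ge (hqx ▸ pow_le_one₀ (norm_nonneg q) h)
  have hqrs : ‖q‖ < r / s := lt_of_pow_lt_pow_left₀ n (by positivity) (hqx ▸ hn)
  obtain ⟨j, hj, hj'⟩ := exists_mem_Ico_zpow hr hq1
  refine ⟨q ^ j, ?_, by rwa [norm_zpow]⟩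
  rw [norm_zpow]
  rw [zpow_add_one₀ (by positivity)] at hj'
  have hjpos : 0 < ‖q‖ ^ j := zpow_pos (by positivity) j
  have : r < ‖q‖ ^ j * (r / s) := hj'.trans (mul_lt_mul_of_pos_left hqrs hjpos)
  rw [← mul_div_assoc, lt_div_iff₀ hs, mul_comm r s] at this
  exact lt_of_mul_lt_mul_right this hr.le

variable {b : ℕ → k} {r : ℝ}

lemma norm_mul_pow_le_of_norm_le (b : ℕ → k) {z : k} (hz : ‖z‖ ≤ r) (n : ℕ) :
    ‖b n * z ^ n‖ ≤ ‖b n‖ * r ^ n := by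
  rw [norm_mul, norm_pow]
  gcongr

variable [IsUltrametricDist k]

lemma summable_mul_pow_of_norm_le [CompleteSpace k]
    (hb : Filter.Tendsto (fun n => ‖b n‖ * r ^ n) Filter.atTop (nhds 0))
    {z : k} (hz : ‖z‖ ≤ r) : Summable fun n => b n * z ^ n := by
  apply NonarchimedeanAddGroup.summable_of_tendsto_cofinite_zero
  rw [Nat.cofinite_eq_atTop]
  exact squeeze_zero_norm (norm_mul_pow_le_of_norm_le b hz) hb

/-- Non-Archimedean Cauchy estimate, obtained by averaging over roots of unity. -/
lemma norm_coeff_mul_pow_le [CompleteSpace k] [IsAlgClosed k]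
    (hres : ∀ m : ℕ, 0 < m → ‖(m : k)‖ = 1)
    (hb : Filter.Tendsto (fun n => ‖b n‖ * r ^ n) Filter.atTop (nhds 0))
    {C : ℝ} (hC0 : 0 ≤ C) (hC : ∀ z : k, ‖z‖ ≤ r → ‖∑' n, b n * z ^ n‖ ≤ C)
    {c : k} (hc : ‖c‖ ≤ r) (m : ℕ) : ‖b m * c ^ m‖ ≤ C := by
  refine le_of_forall_gt_imp_ge_of_dense fun ε hε => ?_
  have hε0 : 0 < ε := hC0.trans_lt hε
  obtain ⟨M, hM⟩ := Filter.eventually_atTop.1 (hb.eventually (gt_mem_nhds hε0))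
  obtain ⟨N, hN⟩ : ∃ N, N = max M (m + 1) := ⟨_, rfl⟩
  have hMN : M ≤ N := by omega
  have hmN : m < N := by omega
  have hN0 : N ≠ 0 := by omega
  have hNk : ‖(N : k)‖ = 1 := hres N (Nat.pos_of_ne_zero hN0)
  have : NeZero (N : k) := ⟨fun h => by simp [h] at hNk⟩
  obtain ⟨ζ, hζ⟩ := HasEnoughRootsOfUnity.exists_primitiveRoot k N
  have hζ0 : ζ ≠ 0 := hζ.ne_zero hN0
  have hζ1 : ‖ζ‖ = 1 := (hζ.isOfFinOrder hN0).norm_eq_one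
  set w : ℕ → k := fun j => ζ ^ j * (ζ⁻¹) ^ m with hw
  have hw1 (j) : ‖w j‖ = 1 := by simp [hw, hζ1]
  have hwm : w m = 1 := by simp [hw, hζ0]
  have hwne (j) (hj : j < N) (hjm : j ≠ m) : w j ≠ 1 := by
    intro h
    refine hjm (hζ.pow_inj hj hmN ?_)
    simpa [hw, ← div_eq_mul_inv, div_eq_one_iff_eq, hζ0] using h
  have hwN (j) : w j ^ N = 1 := by
    simp [hw, mul_pow, ← pow_mul, mul_comm _ N, pow_mul ζ N, hζ.pow_eq_one]
  set G : ℕ → k := fun j => ∑ i ∈ Finset.range N, w j ^ i with hG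
  have hGm : G m = N := by simp [hG, hwm]
  have hG0 (j) (hj : j < N) (hjm : j ≠ m) : G j = 0 := by
    simp [hG, geom_sum_eq (hwne j hj hjm), hwN]
  have hG1 (j) : ‖G j‖ ≤ 1 :=
    IsUltrametricDist.norm_sum_le_of_forall_le_of_nonneg zero_le_one fun i _ => by simp [hw1]
  have hzi (i : ℕ) : ‖c * ζ ^ i‖ ≤ r := by simpa [hζ1] using hc
  have hterm (j i) : (ζ⁻¹) ^ (m * i) * (b j * (c * ζ ^ i) ^ j) = b j * c ^ j * w j ^ i := by
    simp only [hw, mul_pow, ← pow_mul]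
    rw [mul_comm i j]
    ring
  have hsum (i : ℕ) : Summable fun j => b j * c ^ j * w j ^ i := by
    simpa only [hterm] using (summable_mul_pow_of_norm_le hb (hzi i)).mul_left ((ζ⁻¹) ^ (m * i))
  have hsumG : Summable fun j => b j * c ^ j * G j := by
    simpa only [hG, Finset.mul_sum] using summable_sum fun i (_ : i ∈ Finset.range N) => hsum i
  have havg : ‖∑' j, b j * c ^ j * G j‖ ≤ ε := by
    simp only [hG, Finset.mul_sum]
    rw [Summable.tsum_finsetSum fun i _ => hsum i]
    refine IsUltrametricDist.norm_sum_le_of_forall_le_of_nonneg hε0.le fun i _ => ?_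
    simp only [← hterm]
    rw [tsum_mul_left, norm_mul]
    simpa [hζ1] using (hC _ (hzi i)).trans hε.le
  have hrest : ‖∑' j, if j = m then 0 else b j * c ^ j * G j‖ ≤ ε := by
    refine IsUltrametricDist.norm_tsum_le_of_forall_le fun j => ?_
    split_ifs with hjm
    · simpa using hε0.le
    rcases lt_or_ge j N with hj | hj
    · simpa [hG0 j hj hjm] using hε0.le
    · rw [norm_mul]
      refine (mul_le_of_le_one_right (norm_nonneg _) (hG1 j)).trans ?_
      exact (norm_mul_pow_le_of_norm_le b hc j).trans (hM j (hMN.trans hj)).le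
  have hkey := hsumG.tsum_eq_add_tsum_ite m
  rw [← sub_eq_iff_eq_add] at hkey
  calc ‖b m * c ^ m‖ = ‖b m * c ^ m * G m‖ := by rw [norm_mul _ (G m), hGm, hNk, mul_one]
    _ ≤ ε := by
      rw [← hkey, sub_eq_add_neg]
      refine (IsUltrametricDist.norm_add_le_max _ _).trans (max_le havg ?_)
      rwa [norm_neg]

/-- The maximum modulus principle: the sup norm of a power series on a closed ball is its
Gauss norm. -/
lemma iSup_norm_tsum_mul_pow_eq [CompleteSpace k] [IsAlgClosed k]
    (hres : ∀ m : ℕ, 0 < m → ‖(m : k)‖ = 1) (hr : 0 < r)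
    (hb : Filter.Tendsto (fun n => ‖b n‖ * r ^ n) Filter.atTop (nhds 0)) :
    ⨆ z : Metric.closedBall (0 : k) r, ‖∑' n, b n * (z : k) ^ n‖ = ⨆ n, ‖b n‖ * r ^ n := by
  have hle (z : k) (hz : ‖z‖ ≤ r) : ‖∑' n, b n * z ^ n‖ ≤ ⨆ n, ‖b n‖ * r ^ n :=
    IsUltrametricDist.norm_tsum_le_of_forall_le fun n =>
      (norm_mul_pow_le_of_norm_le b hz n).trans (le_ciSup hb.bddAbove_range n)
  have : Nonempty (Metric.closedBall (0 : k) r) := ⟨⟨0, by simpa using hr.le⟩⟩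
  have hbdd : BddAbove (Set.range fun z : Metric.closedBall (0 : k) r =>
      ‖∑' n, b n * (z : k) ^ n‖) :=
    ⟨_, Set.forall_mem_range.2 fun z => hle z (mem_closedBall_zero_iff.1 z.2)⟩
  refine le_antisymm (ciSup_le fun z => hle z (mem_closedBall_zero_iff.1 z.2))
    (ciSup_le fun m => ?_)
  have hcoeff (c : k) (hc : ‖c‖ ≤ r) :=
    norm_coeff_mul_pow_le hres hb (Real.iSup_nonneg fun _ => norm_nonneg _)
      (fun z hz => le_ciSup hbdd ⟨z, mem_closedBall_zero_iff.2 hz⟩) hc m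
  have hcont : Filter.Tendsto (fun s : ℝ => ‖b m‖ * s ^ m) (nhdsWithin r (Set.Iio r))
      (nhds (‖b m‖ * r ^ m)) :=
    (Continuous.tendsto (by fun_prop) r).mono_left nhdsWithin_le_nhds
  refine le_of_tendsto hcont ?_
  filter_upwards [Ioo_mem_nhdsLT hr] with s hs
  obtain ⟨c, hsc, hcr⟩ := exists_lt_norm_le_of_isAlgClosed (k := k) hs.1 hs.2
  refine le_trans ?_ (hcoeff c hcr)
  rw [norm_mul, norm_pow]
  have := hs.1.le
  gcongr

end PowerSeriesOnBall

theorem diameter_eq_radius_mul_deriv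
    {k : Type*} [NontriviallyNormedField k] [CompleteSpace k]
    [IsUltrametricDist k] [IsAlgClosed k]
    (hres : ∀ m : ℕ, 0 < m → ‖(m : k)‖ = 1)
    (r : ℝ) (hr : 0 < r)
    (a : ℕ → k)
    (hconv : Filter.Tendsto (fun n => ‖a n‖ * r ^ n) Filter.atTop (nhds 0)) :
    (⨆ z : Metric.closedBall (0 : k) r,
        ‖(∑' n : ℕ, a n * (z : k) ^ n) - ∑' n : ℕ, a n * (0 : k) ^ n‖)
      = r * ⨆ z : Metric.closedBall (0 : k) r,
          ‖∑' n : ℕ, ((n + 1 : ℕ) : k) * a (n + 1) * (z : k) ^ n‖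
    ∧ (⨆ z : Metric.closedBall (0 : k) r,
        ‖(∑' n : ℕ, a n * (z : k) ^ n) - ∑' n : ℕ, a n * (0 : k) ^ n‖)
      = ⨆ n : ℕ, ‖a (n + 1)‖ * r ^ (n + 1) := by
  have hshift := (Filter.tendsto_add_atTop_iff_nat 1).2 hconv
  have hdiam : (⨆ z : Metric.closedBall (0 : k) r,
      ‖(∑' n : ℕ, a n * (z : k) ^ n) - ∑' n : ℕ, a n * (0 : k) ^ n‖)
      = ⨆ n : ℕ, ‖a (n + 1)‖ * r ^ (n + 1) := by
    set b : ℕ → k := Function.update a 0 0 with hbdef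
    have hb0 : b 0 = 0 := by simp [hbdef]
    have hbs (n : ℕ) : b (n + 1) = a (n + 1) := by simp [hbdef]
    have hb : Filter.Tendsto (fun n => ‖b n‖ * r ^ n) Filter.atTop (nhds 0) := by
      rw [← Filter.tendsto_add_atTop_iff_nat 1]
      simpa only [hbs] using hshift
    have hf (z : Metric.closedBall (0 : k) r) :
        (∑' n, a n * (z : k) ^ n) - ∑' n, a n * (0 : k) ^ n = ∑' n, b n * (z : k) ^ n := by
      have hz : ‖(z : k)‖ ≤ r := mem_closedBall_zero_iff.1 z.2
      rw [(summable_mul_pow_of_norm_le hconv hz).tsum_eq_zero_add,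
        (summable_mul_pow_of_norm_le hb hz).tsum_eq_zero_add,
        tsum_eq_single (f := fun n => a n * (0 : k) ^ n) 0 fun n hn => by simp [hn]]
      simp [hb0, hbs]
    simp only [hf]
    rw [iSup_norm_tsum_mul_pow_eq hres hr hb]
    refine le_antisymm (ciSup_le fun n => ?_) (ciSup_le fun n => ?_)
    · cases n with
      | zero => simpa [hb0] using Real.iSup_nonneg fun n => by positivity
      | succ n => simpa only [hbs] using le_ciSup hshift.bddAbove_range n
    · simpa only [hbs] using le_ciSup hb.bddAbove_range (n + 1)
  refine ⟨?_, hdiam⟩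
  have hnorm (n : ℕ) : r * (‖((n + 1 : ℕ) : k) * a (n + 1)‖ * r ^ n)
      = ‖a (n + 1)‖ * r ^ (n + 1) := by
    rw [norm_mul, hres (n + 1) n.succ_pos]
    ring
  have hderiv : Filter.Tendsto (fun n => ‖((n + 1 : ℕ) : k) * a (n + 1)‖ * r ^ n)
      Filter.atTop (nhds 0) := by
    simpa [← hnorm, hr.ne'] using hshift.const_mul r⁻¹
  rw [hdiam, iSup_norm_tsum_mul_pow_eq hres hr hderiv, Real.mul_iSup_of_nonneg hr.le]
  simp only [hnorm]
end

section
/- Non-Archimedean Zalcman reparametrization lemma: For each n ∈ ℕ let f_n = (f_{n,0}, …, f_{n,N}) be an (N+1)-tuple of power series f_{n,i}(z) = ∑_{m≥0} a_{n,i,m} z^m with coefficients in k such that |a_{n,i,m}|·r^m → 0 as m → ∞ for every 0 < r < 1 (so each f_{n,i} converges on the open unit disk D(k) = {z ∈ k : |z| < 1}), and such that for every z ∈ D(k) not all f_{n,i}(z) vanish. Suppose the Fubini–Study derivatives of the f_n are not locally uniformly bounded at some point z_0 ∈ D(k), i.e. for every ε > 0 and C > 0 there exist n ∈ ℕ and z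 ∈ D(k) with |z − z_0| < ε and |f_n'(z)| > C. Then there exist a strictly increasing sequence (n_j) of natural numbers, points z_j ∈ k with z_j → z_0, and nonzero scalars ρ_j ∈ k with |ρ_j| → 0, such that the rescaled tuples g_j := (z ↦ f_{n_j,i}(z_j + ρ_j·z))_{0≤i≤N} satisfy: (i) for every z ∈ k with |z| < j one has |z_j + ρ_j·z| < 1, so g_j is defined on the disk of radius j; (ii) for every R > 0 there exists C > 0 such that |g_j'(z)| ≤ C for every j ≥ R and every z ∈ k with |z| ≤ R; (iii) |g_j'(0)| = 1 for every j (here |g_j'(·)| denotes the Fubini–Study derivative of the tuple g_j). -/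
/-!
Non-Archimedean Zalcman reparametrization lemma.

For each `n`, `f n = (f n 0, …, f n N)` is a tuple of power series with
coefficients `a n i m`, converging on the open unit disk, with no common zero
there; `f' n i z` is the derivative of `f n i` at `z`.  If the Fubini–Study
derivatives of the tuples `f n` are not locally uniformly bounded at a point
`z0` of the open unit disk, there are a strictly increasing sequence `n j`,
points `zc j → z0` and nonzero scalars `ρ j` with `‖ρ j‖ → 0` such that the
rescaled tuples `g j = (z ↦ f (n j) i (zc j + ρ j * z))_i` satisfy:
(i) `g j` is defined on the disk of radius `j`;
(ii) for every `R > 0` there is `C > 0` bounding the Fubini–Study derivative of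
`g j` on `‖z‖ ≤ R` for all `j ≥ R`;
(iii) the Fubini–Study derivative of `g j` at `0` equals `1` for all `j`.
-/

/-- The Fubini–Study derivative at `z` of a tuple of maps `f` with (pointwise)
derivatives `f'`. -/
noncomputable def fsDeriv {k : Type*} [NontriviallyNormedField k] {N : ℕ}
    (f f' : Fin (N + 1) → k → k) (z : k) : ℝ :=
  max 1 (‖z‖ ^ 2) *
      (⨆ p : Fin (N + 1) × Fin (N + 1),
        ‖f' p.1 z * f p.2 z - f' p.2 z * f p.1 z‖) /
    (⨆ i, ‖f i z‖) ^ 2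

section PowerSeries

variable {k : Type*} [NontriviallyNormedField k] [IsUltrametricDist k]

theorem norm_pow_sub_pow_mul_le {x y : k} {r : ℝ} (hx : ‖x‖ ≤ r) (hy : ‖y‖ ≤ r) (m : ℕ) :
    ‖x ^ m - y ^ m‖ * r ≤ ‖x - y‖ * r ^ m := by
  have hr : 0 ≤ r := (norm_nonneg x).trans hx
  induction m with
  | zero => simp
  | succ m ih =>
    have key : x ^ (m + 1) - y ^ (m + 1) = x ^ m * (x - y) + (x ^ m - y ^ m) * y := by ring
    have h1 : ‖x ^ m * (x - y)‖ ≤ ‖x - y‖ * r ^ m := by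
      rw [norm_mul, norm_pow, mul_comm]
      gcongr
    have h2 : ‖(x ^ m - y ^ m) * y‖ ≤ ‖x - y‖ * r ^ m := by
      rw [norm_mul]
      exact (mul_le_mul_of_nonneg_left hy (norm_nonneg _)).trans ih
    rw [key, pow_succ, ← mul_assoc]
    exact mul_le_mul_of_nonneg_right
      ((IsUltrametricDist.norm_add_le_max _ _).trans (max_le h1 h2)) hr

theorem summable_mul_pow_of_tendsto [CompleteSpace k] {a : ℕ → k} {r : ℝ}
    (h : Filter.Tendsto (fun m => ‖a m‖ * r ^ m) Filter.atTop (nhds 0)) {x : k} (hx : ‖x‖ ≤ r) :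
    Summable fun m => a m * x ^ m := by
  apply NonarchimedeanAddGroup.summable_of_tendsto_cofinite_zero
  rw [Nat.cofinite_eq_atTop]
  refine squeeze_zero_norm (fun m => ?_) h
  rw [norm_mul, norm_pow]
  gcongr

theorem exists_lipschitz_tsum_mul_pow [CompleteSpace k] {a : ℕ → k} {r : ℝ} (hr : 0 < r)
    (h : Filter.Tendsto (fun m => ‖a m‖ * r ^ m) Filter.atTop (nhds 0)) :
    ∃ C, 0 ≤ C ∧ ∀ x y : k, ‖x‖ ≤ r → ‖y‖ ≤ r →
      ‖∑' m, a m * x ^ m - ∑' m, a m * y ^ m‖ ≤ C * ‖x - y‖ := by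
  obtain ⟨B, hB⟩ := h.bddAbove_range
  have hB' : ∀ m, ‖a m‖ * r ^ m ≤ B := fun m => hB ⟨m, rfl⟩
  have hB0 : 0 ≤ B := le_trans (by positivity) (hB' 0)
  refine ⟨B / r, by positivity, fun x y hx hy => ?_⟩
  rw [← (summable_mul_pow_of_tendsto h hx).tsum_sub (summable_mul_pow_of_tendsto h hy)]
  refine IsUltrametricDist.norm_tsum_le_of_forall_le_of_nonneg (by positivity) fun m => ?_
  rw [← mul_sub, norm_mul, div_mul_eq_mul_div, le_div_iff₀ hr, mul_assoc]
  calc ‖a m‖ * (‖x ^ m - y ^ m‖ * r) ≤ ‖a m‖ * (‖x - y‖ * r ^ m) := by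
        exact mul_le_mul_of_nonneg_left (norm_pow_sub_pow_mul_le hx hy m) (norm_nonneg _)
    _ = ‖a m‖ * r ^ m * ‖x - y‖ := by ring
    _ ≤ B * ‖x - y‖ := by
        gcongr
        exact hB' m

theorem exists_eventually_norm_deriv_le [CompleteSpace k] {a : ℕ → k}
    (hconv : ∀ r : ℝ, 0 < r → r < 1 →
      Filter.Tendsto (fun m => ‖a m‖ * r ^ m) Filter.atTop (nhds 0))
    {f f' : k → k} (hf : ∀ z : k, ‖z‖ < 1 → f z = ∑' m : ℕ, a m * z ^ m)
    (hf' : ∀ z : k, ‖z‖ < 1 → HasDerivAt f (f' z) z) {w : k} (hw : ‖w‖ < 1) :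
    ∃ C, ∀ᶠ z in nhds w, ‖f' z‖ ≤ C := by
  obtain ⟨r, hwr, hr1⟩ := exists_between hw
  have hr : 0 < r := (norm_nonneg w).trans_lt hwr
  obtain ⟨C, hC0, hC⟩ := exists_lipschitz_tsum_mul_pow hr (hconv r hr hr1)
  have hnear : ∀ z : k, ‖z‖ < r → ∀ᶠ x in nhds z, ‖x‖ < r := fun z hz =>
    continuous_norm.continuousAt.eventually_lt continuousAt_const hz
  refine ⟨C, (hnear w hwr).mono fun z hz => ?_⟩
  refine (hf' z (hz.trans hr1)).le_of_lip' hC0 ((hnear z hz).mono fun x hx => ?_)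
  rw [hf x (hx.trans hr1), hf z (hz.trans hr1)]
  exact hC x z hx.le hz.le

end PowerSeries

section FubiniStudy

variable {k : Type*} [NontriviallyNormedField k] {N : ℕ}

theorem fsDeriv_nonneg (f f' : Fin (N + 1) → k → k) (z : k) : 0 ≤ fsDeriv f f' z :=
  div_nonneg (mul_nonneg (by positivity) (Real.iSup_nonneg fun _ => norm_nonneg _))
    (by positivity)

theorem exists_norm_eq_fsDeriv (f f' : Fin (N + 1) → k → k) {z : k} (hz : ‖z‖ ≤ 1) :
    ∃ c : k, ‖c‖ = fsDeriv f f' z := by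
  obtain ⟨p, hp⟩ := exists_eq_ciSup_of_finite
    (f := fun p : Fin (N + 1) × Fin (N + 1) => ‖f' p.1 z * f p.2 z - f' p.2 z * f p.1 z‖)
  obtain ⟨i, hi⟩ := exists_eq_ciSup_of_finite (f := fun i => ‖f i z‖)
  refine ⟨(f' p.1 z * f p.2 z - f' p.2 z * f p.1 z) / f i z ^ 2, ?_⟩
  rw [fsDeriv, ← hp, ← hi, max_eq_left (pow_le_one₀ (norm_nonneg z) hz), one_mul, norm_div,
    norm_pow]

theorem fsDeriv_comp_affine (f f' : Fin (N + 1) → k → k) (c ρ z : k) (h : ‖c + ρ * z‖ ≤ 1) :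
    fsDeriv (fun i t => f i (c + ρ * t)) (fun i t => ρ * f' i (c + ρ * t)) z =
      max 1 (‖z‖ ^ 2) * (‖ρ‖ * fsDeriv f f' (c + ρ * z)) := by
  have key : ∀ a b a' b' : k, ‖ρ * a' * b - ρ * b' * a‖ = ‖ρ‖ * ‖a' * b - b' * a‖ := by
    intro a b a' b'
    rw [← norm_mul]
    congr 1
    ring
  simp only [fsDeriv, key, max_eq_left (pow_le_one₀ (n := 2) (norm_nonneg _) h),
    ← Real.mul_iSup_of_nonneg (norm_nonneg ρ)]
  ring

theorem exists_eventually_fsDeriv_le {f f' : Fin (N + 1) → k → k} {w : k}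
    (hf : ∀ i, ContinuousAt (f i) w) (hf' : ∀ i, ∃ C, ∀ᶠ z in nhds w, ‖f' i z‖ ≤ C)
    (hne : ∃ i, f i w ≠ 0) : ∃ B, ∀ᶠ z in nhds w, fsDeriv f f' z ≤ B := by
  choose C hC using hf'
  obtain ⟨i₀, hi₀⟩ := hne
  have hδ : 0 < ‖f i₀ w‖ := norm_pos_iff.mpr hi₀
  have hC' : ∀ᶠ z in nhds w, ∀ i, ‖f' i z‖ ≤ C i := Filter.eventually_all.mpr hC
  have hD : ∀ᶠ z in nhds w, ∀ i, ‖f i z‖ < ‖f i w‖ + 1 := Filter.eventually_all.mpr fun i =>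
    (hf i).norm.eventually_lt continuousAt_const (lt_add_one _)
  have hL : ∀ᶠ z in nhds w, ‖f i₀ w‖ / 2 < ‖f i₀ z‖ :=
    continuousAt_const.eventually_lt (hf i₀).norm (half_lt_self hδ)
  have hW : ∀ᶠ z in nhds w, ‖z‖ < ‖w‖ + 1 :=
    continuous_norm.continuousAt.eventually_lt continuousAt_const (lt_add_one _)
  refine ⟨max 1 ((‖w‖ + 1) ^ 2) * (⨆ p : Fin (N + 1) × Fin (N + 1),
    (C p.1 * (‖f p.2 w‖ + 1) + C p.2 * (‖f p.1 w‖ + 1))) / (‖f i₀ w‖ / 2) ^ 2, ?_⟩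
  filter_upwards [hC', hD, hL, hW] with z h1 h2 h3 h4
  have hprod : ∀ i j, ‖f' i z * f j z‖ ≤ C i * (‖f j w‖ + 1) := fun i j => by
    rw [norm_mul]
    exact mul_le_mul (h1 i) (h2 j).le (norm_nonneg _) ((norm_nonneg _).trans (h1 i))
  have hsup : (⨆ p : Fin (N + 1) × Fin (N + 1),
      ‖f' p.1 z * f p.2 z - f' p.2 z * f p.1 z‖) ≤ ⨆ p : Fin (N + 1) × Fin (N + 1),
      (C p.1 * (‖f p.2 w‖ + 1) + C p.2 * (‖f p.1 w‖ + 1)) :=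
    ciSup_mono (Set.finite_range _).bddAbove fun p =>
      (norm_sub_le _ _).trans (add_le_add (hprod _ _) (hprod _ _))
  have hden : ‖f i₀ w‖ / 2 ≤ ⨆ i, ‖f i z‖ :=
    h3.le.trans (le_ciSup (f := fun i => ‖f i z‖) (Set.finite_range _).bddAbove i₀)
  have hsup0 := Real.iSup_nonneg fun p : Fin (N + 1) × Fin (N + 1) =>
    norm_nonneg (f' p.1 z * f p.2 z - f' p.2 z * f p.1 z)
  have hsup1 := hsup0.trans hsup
  unfold fsDeriv
  gcongr

end FubiniStudy

theorem exists_doubling_point {k : Type*} [NormedField k] [CompleteSpace k] [IsUltrametricDist k]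
    {F : k → ℝ} (hF : ∀ w, ‖w‖ < 1 → ∃ B, ∀ᶠ z in nhds w, F z ≤ B)
    {L M : ℝ} (hL : 0 ≤ L) (hM : 0 < M) (hLM : L / M < 1) {z : k} (hz : ‖z‖ < 1) (hFz : M ≤ F z) :
    ∃ z', ‖z' - z‖ ≤ L / M ∧ M ≤ F z' ∧ ∀ w, ‖w - z'‖ ≤ L / F z' → F w ≤ 2 * F z' := by
  by_contra! hcon
  choose! g hg1 hg2 using hcon
  have hstep : ∀ x, ‖x - z‖ ≤ L / M → M ≤ F x → ‖g x - z‖ ≤ L / M ∧ M ≤ F (g x) := by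
    intro x hx hMx
    refine ⟨?_, by linarith [hg2 x hx hMx]⟩
    rw [← sub_add_sub_cancel (g x) x z]
    refine (IsUltrametricDist.norm_add_le_max _ _).trans (max_le ((hg1 x hx hMx).trans ?_) hx)
    gcongr
  set u : ℕ → k := fun m => g^[m] z with hu
  have hsucc : ∀ m, u (m + 1) = g (u m) := fun m => Function.iterate_succ_apply' g m z
  have hmem : ∀ m, ‖u m - z‖ ≤ L / M ∧ M ≤ F (u m) := by
    intro m
    induction m with
    | zero => simpa [hu, hFz] using div_nonneg hL hM.le
    | succ m ih => rw [hsucc]; exact hstep _ ih.1 ih.2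
  have hgrow : ∀ m, M * 2 ^ m ≤ F (u m) := by
    intro m
    induction m with
    | zero => simpa using (hmem 0).2
    | succ m ih =>
      rw [hsucc, pow_succ]
      linarith [hg2 (u m) (hmem m).1 (hmem m).2]
  have hcauchy : CauchySeq u := by
    refine cauchySeq_of_le_geometric (1 / 2) (L / M) (by norm_num) fun m => ?_
    rw [dist_comm, dist_eq_norm, hsucc]
    refine (hg1 (u m) (hmem m).1 (hmem m).2).trans ?_
    rw [one_div, inv_pow, ← div_eq_mul_inv, div_div]
    gcongr
    exact hgrow m
  obtain ⟨x, hx⟩ := cauchySeq_tendsto_of_complete hcauchy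
  have hxz : ‖x - z‖ ≤ L / M := le_of_tendsto (hx.sub_const z).norm (.of_forall fun m => (hmem m).1)
  have hx1 : ‖x‖ < 1 := by
    rw [← sub_add_cancel x z]
    exact (IsUltrametricDist.norm_add_le_max _ _).trans_lt (max_lt (hxz.trans_lt hLM) hz)
  obtain ⟨B, hB⟩ := hF x hx1
  have htop : Filter.Tendsto (fun m => F (u m)) Filter.atTop Filter.atTop :=
    Filter.tendsto_atTop_mono hgrow
      ((tendsto_pow_atTop_atTop_of_one_lt one_lt_two).const_mul_atTop hM)
  obtain ⟨m, hm1, hm2⟩ := ((hx.eventually hB).and (htop.eventually_gt_atTop B)).exists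
  exact hm1.not_gt hm2

theorem zalcman_reparametrization
    {k : Type*} [NontriviallyNormedField k] [CompleteSpace k]
    [IsUltrametricDist k] [IsAlgClosed k]
    (N : ℕ) (a : ℕ → Fin (N + 1) → ℕ → k)
    (hconv : ∀ n i (r : ℝ), 0 < r → r < 1 →
      Filter.Tendsto (fun m => ‖a n i m‖ * r ^ m) Filter.atTop (nhds 0))
    (f f' : ℕ → Fin (N + 1) → k → k)
    (hf : ∀ n i (z : k), ‖z‖ < 1 → f n i z = ∑' m : ℕ, a n i m * z ^ m)
    (hf' : ∀ n i (z : k), ‖z‖ < 1 → HasDerivAt (f n i) (f' n i z) z)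
    (hnz : ∀ n (z : k), ‖z‖ < 1 → ∃ i, f n i z ≠ 0)
    (z0 : k) (hz0 : ‖z0‖ < 1)
    (hub : ∀ ε > (0 : ℝ), ∀ C > (0 : ℝ), ∃ n, ∃ z : k,
      ‖z - z0‖ < ε ∧ ‖z‖ < 1 ∧ C < fsDeriv (f n) (f' n) z) :
    ∃ n : ℕ → ℕ, StrictMono n ∧
    ∃ zc : ℕ → k, Filter.Tendsto zc Filter.atTop (nhds z0) ∧
    ∃ ρ : ℕ → k, (∀ j, ρ j ≠ 0) ∧
      Filter.Tendsto (fun j => ‖ρ j‖) Filter.atTop (nhds 0) ∧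
      (∀ j : ℕ, ∀ z : k, ‖z‖ < (j : ℝ) → ‖zc j + ρ j * z‖ < 1) ∧
      (∀ R > (0 : ℝ), ∃ C > (0 : ℝ), ∀ j : ℕ, R ≤ (j : ℝ) →
        ∀ z : k, ‖z‖ ≤ R →
          fsDeriv (fun i t => f (n j) i (zc j + ρ j * t))
            (fun i t => ρ j * f' (n j) i (zc j + ρ j * t)) z ≤ C) ∧
      (∀ j, fsDeriv (fun i t => f (n j) i (zc j + ρ j * t))
          (fun i t => ρ j * f' (n j) i (zc j + ρ j * t)) 0 = 1) := by
  have hloc : ∀ n (w : k), ‖w‖ < 1 → ∃ B, ∀ᶠ z in nhds w, fsDeriv (f n) (f' n) z ≤ B :=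
    fun n w hw => exists_eventually_fsDeriv_le (fun i => (hf' n i w hw).continuousAt)
      (fun i => exists_eventually_norm_deriv_le (hconv n i) (hf n i) (hf' n i) hw) (hnz n w hw)
  have hlarge : ∀ ε > (0 : ℝ), ∀ C > (0 : ℝ), ∀ m, ∃ n ≥ m, ∃ z : k,
      ‖z - z0‖ < ε ∧ ‖z‖ < 1 ∧ C < fsDeriv (f n) (f' n) z := by
    intro ε hε C hC m
    choose B hB using fun n => hloc n z0 hz0
    have hall : ∀ᶠ z in nhds z0, ∀ n ∈ Finset.range m, fsDeriv (f n) (f' n) z ≤ B n :=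
      (Filter.eventually_all_finset _).mpr fun n _ => hB n
    obtain ⟨δ, hδ, hball⟩ := Metric.eventually_nhds_iff.mp hall
    obtain ⟨n, z, hz, hz1, hCz⟩ := hub (min ε δ) (lt_min hε hδ)
      (C + ∑ n ∈ Finset.range m, |B n|) (by positivity)
    have hsum : 0 ≤ ∑ n ∈ Finset.range m, |B n| := by positivity
    refine ⟨n, ?_, z, hz.trans_le (min_le_left _ _), hz1, by linarith⟩
    by_contra! hnm
    have h1 := hball (by rw [dist_eq_norm]; exact hz.trans_le (min_le_right _ _)) n
      (Finset.mem_range.mpr hnm)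
    have h2 : |B n| ≤ ∑ n ∈ Finset.range m, |B n| :=
      Finset.single_le_sum (f := fun n => |B n|) (fun _ _ => abs_nonneg _)
        (Finset.mem_range.mpr hnm)
    linarith [le_abs_self (B n)]
  have hfreq : ∀ j : ℕ, ∃ᶠ n in Filter.atTop, ∃ c ρ : k, ρ ≠ 0 ∧
      ‖c - z0‖ ≤ 1 / ((j : ℝ) + 1) ∧ ‖ρ‖ ≤ 1 / ((j : ℝ) + 1) ∧
      ‖c‖ < 1 ∧ ‖ρ‖ * fsDeriv (f n) (f' n) c = 1 ∧
      ∀ w : k, ‖w‖ ≤ j →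
        ‖c + ρ * w‖ < 1 ∧ ‖ρ‖ * fsDeriv (f n) (f' n) (c + ρ * w) ≤ 2 := by
    intro j
    rw [Filter.frequently_atTop]
    intro m
    have hj : (0 : ℝ) ≤ j := j.cast_nonneg
    set M : ℝ := ((j : ℝ) + 1) ^ 2 with hM
    have hM0 : 0 < M := by positivity
    have hjM : (j : ℝ) / M < 1 := by
      rw [div_lt_one hM0]
      nlinarith
    have hjM' : (j : ℝ) / M ≤ 1 / ((j : ℝ) + 1) := by
      rw [div_le_div_iff₀ hM0 (by positivity)]
      nlinarith
    obtain ⟨n, hn, z, hzz0, hz1, hFz⟩ := hlarge (1 / ((j : ℝ) + 1)) (by positivity) M hM0 m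
    obtain ⟨c, hcz, hFc, hdouble⟩ := exists_doubling_point (hloc n) hj hM0 hjM hz1 hFz.le
    have hc1 : ‖c‖ < 1 := by
      rw [← sub_add_cancel c z]
      exact (IsUltrametricDist.norm_add_le_max _ _).trans_lt (max_lt (hcz.trans_lt hjM) hz1)
    obtain ⟨b, hb⟩ := exists_norm_eq_fsDeriv (f n) (f' n) hc1.le
    have hFc0 : 0 < fsDeriv (f n) (f' n) c := hM0.trans_le hFc
    have hb0 : b ≠ 0 := norm_pos_iff.mp (hb ▸ hFc0)
    refine ⟨n, hn, c, b⁻¹, inv_ne_zero hb0, ?_, ?_, hc1, ?_, fun w hw => ?_⟩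
    · rw [← sub_add_sub_cancel c z z0]
      exact (IsUltrametricDist.norm_add_le_max _ _).trans (max_le (hcz.trans hjM') hzz0.le)
    · rw [norm_inv, hb, ← one_div]
      gcongr
      nlinarith
    · rw [norm_inv, hb, inv_mul_cancel₀ hFc0.ne']
    · have hle : ‖b⁻¹ * w‖ ≤ j / fsDeriv (f n) (f' n) c := by
        rw [norm_mul, norm_inv, hb, inv_mul_eq_div]
        gcongr
      have hle1 : ‖b⁻¹ * w‖ < 1 := hle.trans_lt (lt_of_le_of_lt (by gcongr) hjM)
      refine ⟨(IsUltrametricDist.norm_add_le_max _ _).trans_lt (max_lt hc1 hle1), ?_⟩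
      rw [norm_inv, hb, inv_mul_le_iff₀ hFc0, mul_comm _ (2 : ℝ)]
      exact hdouble _ (by simpa using hle)
  obtain ⟨n, hn, hP⟩ := Filter.extraction_forall_of_frequently hfreq
  choose zc ρ hρ0 hzc hρ hzc1 hone hdisk using hP
  have hlim : Filter.Tendsto (fun j : ℕ => 1 / ((j : ℝ) + 1)) Filter.atTop (nhds 0) :=
    tendsto_one_div_add_atTop_nhds_zero_nat
  refine ⟨n, hn, zc, ?_, ρ, hρ0, squeeze_zero (fun _ => norm_nonneg _) hρ hlim,
    fun j z hz => (hdisk j z hz.le).1, fun R hR => ?_, fun j => ?_⟩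
  · exact tendsto_iff_norm_sub_tendsto_zero.mpr
      (squeeze_zero (fun _ => norm_nonneg _) hzc hlim)
  · refine ⟨max 1 (R ^ 2) * 2, by positivity, fun j hj z hz => ?_⟩
    obtain ⟨h1, h2⟩ := hdisk j z (hz.trans hj)
    rw [fsDeriv_comp_affine _ _ _ _ _ h1.le]
    have := fsDeriv_nonneg (f (n j)) (f' (n j)) (zc j + ρ j * z)
    gcongr
  · rw [fsDeriv_comp_affine _ _ _ _ _ (by simpa using (hzc1 j).le)]
    simpa using hone j
end

section
/- A nonvanishing analytic function on an open annulus has a monomially dominated coefficient family: Let 0 < ρ < 1 and let a : ℤ → k be such that for every r with ρ < r < 1 one has |a_n|·r^n → 0 along the cofinite filter on ℤ (so F(z) := ∑_{n∈ℤ} a_n z^n converges for every z ∈ k with ρ < |z| < 1), and such that not all a_n are 0. If F(z) ≠ 0 for every z ∈ k with ρ < |z| < 1, then there exists n_0 ∈ ℤ such that for every r with ρ < r < 1 and every n ∈ ℤ one has |a_n|·r^n ≤ |a_{n_0}|·r^{n_0}; moreover |F(z)| = |a_{n_0}|·|z|^{n_0} for every z ∈ k with ρ < |z| < 1. -/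
section UltrametricNorm

variable {E : Type*} [SeminormedAddCommGroup E] [IsUltrametricDist E]

lemma ultra_norm_sub_le {x y : E} {B : ℝ} (hx : ‖x‖ ≤ B) (hy : ‖y‖ ≤ B) :
    ‖x - y‖ ≤ B := by
  rw [sub_eq_add_neg]
  exact (IsUltrametricDist.norm_add_le_max _ _).trans (max_le hx (by rwa [norm_neg]))

lemma ultra_norm_sub_lt {x y : E} {B : ℝ} (hx : ‖x‖ < B) (hy : ‖y‖ < B) :
    ‖x - y‖ < B := by
  rw [sub_eq_add_neg]
  exact (IsUltrametricDist.norm_add_le_max _ _).trans_lt (max_lt hx (by rwa [norm_neg]))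

lemma ultra_norm_sub_eq_left {x y : E} (h : ‖y‖ < ‖x‖) : ‖x - y‖ = ‖x‖ := by
  rw [sub_eq_add_neg,
    IsUltrametricDist.norm_add_eq_max_of_norm_ne_norm (by rw [norm_neg]; exact h.ne'), norm_neg,
    max_eq_left h.le]

lemma ultra_norm_sub_eq_right {x y : E} (h : ‖x‖ < ‖y‖) : ‖x - y‖ = ‖y‖ := by
  rw [norm_sub_rev, ultra_norm_sub_eq_left h]

end UltrametricNorm

section GaussWindow

open Polynomial

variable {k : Type*} [NormedField k]

/-- The Gauss norm of `p` is `g`, it is attained at the degrees `i` and `i + d`, and at no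
degree outside `[i, i + d]`. -/
def GaussWindow (p : k[X]) (g : ℝ) (i d : ℕ) : Prop :=
  ‖p.coeff i‖ = g ∧ ‖p.coeff (i + d)‖ = g ∧ (∀ n, ‖p.coeff n‖ ≤ g) ∧
    ∀ n, n < i ∨ i + d < n → ‖p.coeff n‖ < g

lemma GaussWindow.unique {p : k[X]} {g g' : ℝ} {i i' d d' : ℕ}
    (h : GaussWindow p g i d) (h' : GaussWindow p g' i' d') : g = g' ∧ i = i' ∧ d = d' := by
  obtain ⟨h1, h2, h3, h4⟩ := h
  obtain ⟨h1', h2', h3', h4'⟩ := h'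
  have hg : g = g' := le_antisymm (h1 ▸ h3' i) (h1' ▸ h3 i')
  subst hg
  have key : ∀ n, ‖p.coeff n‖ = g → (i ≤ n ∧ n ≤ i + d) ∧ (i' ≤ n ∧ n ≤ i' + d') := by
    intro n hn
    have e1 := mt (h4 n) (by rw [hn]; exact lt_irrefl g)
    have e2 := mt (h4' n) (by rw [hn]; exact lt_irrefl g)
    omega
  have := key _ h1
  have := key _ h2
  have := key _ h1'
  have := key _ h2'
  exact ⟨rfl, by omega, by omega⟩

lemma GaussWindow.C_mul {p : k[X]} {g : ℝ} {i d : ℕ} {c : k} (hc : c ≠ 0)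
    (h : GaussWindow p g i d) : GaussWindow (C c * p) (‖c‖ * g) i d := by
  obtain ⟨h1, h2, h3, h4⟩ := h
  have hc' := norm_pos_iff.2 hc
  refine ⟨by simp [h1], by simp [h2], fun n => ?_, fun n hn => ?_⟩
  · rw [coeff_C_mul, norm_mul]
    exact mul_le_mul_of_nonneg_left (h3 n) hc'.le
  · rw [coeff_C_mul, norm_mul]
    exact mul_lt_mul_of_pos_left (h4 n hn) hc'

variable [IsUltrametricDist k]

lemma GaussWindow.mul_X_sub_C_of_lt {p : k[X]} {g : ℝ} {i d : ℕ} {α : k} (hg : 0 < g)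
    (h : GaussWindow p g i d) (hα : ‖α‖ < 1) : GaussWindow (p * (X - C α)) g (i + 1) d := by
  obtain ⟨h1, h2, h3, h4⟩ := h
  have hlt : ∀ n, ‖p.coeff n * α‖ < g := fun n => by
    rw [norm_mul]
    have := h3 n
    nlinarith [norm_nonneg α, norm_nonneg (p.coeff n)]
  refine ⟨?_, ?_, fun n => ?_, fun n hn => ?_⟩
  · rw [coeff_mul_X_sub_C, ultra_norm_sub_eq_left (by rw [h1]; exact hlt _), h1]
  · rw [Nat.add_right_comm, coeff_mul_X_sub_C, ultra_norm_sub_eq_left (by rw [h2]; exact hlt _), h2]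
  · cases n with
    | zero => simpa [mul_coeff_zero] using (hlt 0).le
    | succ n =>
      rw [coeff_mul_X_sub_C]
      exact ultra_norm_sub_le (h3 n) (hlt _).le
  · cases n with
    | zero => simpa [mul_coeff_zero] using hlt 0
    | succ n =>
      rw [coeff_mul_X_sub_C]
      exact ultra_norm_sub_lt (h4 n (by omega)) (hlt _)

lemma GaussWindow.mul_X_sub_C_of_eq {p : k[X]} {g : ℝ} {i d : ℕ} {α : k}
    (h : GaussWindow p g i d) (hα : ‖α‖ = 1) : GaussWindow (p * (X - C α)) g i (d + 1) := by
  obtain ⟨h1, h2, h3, h4⟩ := h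
  have he : ∀ n, ‖p.coeff n * α‖ = ‖p.coeff n‖ := fun n => by rw [norm_mul, hα, mul_one]
  refine ⟨?_, ?_, fun n => ?_, fun n hn => ?_⟩
  · cases i with
    | zero => simpa [mul_coeff_zero, hα] using h1
    | succ i =>
      rw [coeff_mul_X_sub_C, ultra_norm_sub_eq_right (by rw [he, h1]; exact h4 _ (by omega)),
        he, h1]
  · rw [← add_assoc, coeff_mul_X_sub_C,
      ultra_norm_sub_eq_left (by rw [he, h2]; exact h4 _ (by omega)), h2]
  · cases n with
    | zero => simpa [mul_coeff_zero, hα] using h3 0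
    | succ n =>
      rw [coeff_mul_X_sub_C]
      exact ultra_norm_sub_le (h3 n) (by rw [he]; exact h3 _)
  · cases n with
    | zero => simpa [mul_coeff_zero, hα] using h4 0 (by omega)
    | succ n =>
      rw [coeff_mul_X_sub_C]
      exact ultra_norm_sub_lt (h4 n (by omega)) (by rw [he]; exact h4 _ (by omega))

lemma GaussWindow.mul_X_sub_C_of_gt {p : k[X]} {g : ℝ} {i d : ℕ} {α : k} (hg : 0 < g)
    (h : GaussWindow p g i d) (hα : 1 < ‖α‖) :
    GaussWindow (p * (X - C α)) (g * ‖α‖) i d := by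
  obtain ⟨h1, h2, h3, h4⟩ := h
  have hlt : ∀ n, ‖p.coeff n‖ < g * ‖α‖ := fun n => (h3 n).trans_lt (by nlinarith)
  have hle : ∀ n, ‖p.coeff n * α‖ ≤ g * ‖α‖ := fun n => by
    rw [norm_mul]
    exact mul_le_mul_of_nonneg_right (h3 n) (norm_nonneg _)
  have hlt' : ∀ n, n < i ∨ i + d < n → ‖p.coeff n * α‖ < g * ‖α‖ := fun n hn => by
    rw [norm_mul]
    exact mul_lt_mul_of_pos_right (h4 n hn) (by linarith)
  have hat : ∀ n, ‖p.coeff n‖ = g → ‖(p * (X - C α)).coeff n‖ = g * ‖α‖ := by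
    intro n hn
    cases n with
    | zero => simp [mul_coeff_zero, hn]
    | succ n =>
      have : ‖p.coeff (n + 1) * α‖ = g * ‖α‖ := by rw [norm_mul, hn]
      rw [coeff_mul_X_sub_C, ultra_norm_sub_eq_right (by rw [this]; exact hlt n), this]
  refine ⟨hat _ h1, hat _ h2, fun n => ?_, fun n hn => ?_⟩
  · cases n with
    | zero => simpa [mul_coeff_zero] using hle 0
    | succ n =>
      rw [coeff_mul_X_sub_C]
      exact ultra_norm_sub_le (hlt n).le (hle _)
  · cases n with
    | zero => simpa [mul_coeff_zero] using hlt' 0 hn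
    | succ n =>
      rw [coeff_mul_X_sub_C]
      exact ultra_norm_sub_lt (hlt n) (hlt' _ hn)

lemma exists_gaussWindow_prod_X_sub_C (s : Multiset k) :
    ∃ (g : ℝ) (i d : ℕ), 0 < g ∧ GaussWindow (s.map fun α => X - C α).prod g i d ∧
      ∀ (z : k) (δ : ℝ), ‖z‖ = 1 → 0 ≤ δ → (∀ α ∈ s, ‖α‖ = 1 → δ ≤ ‖α - z‖) →
        g * δ ^ d ≤ ‖(s.map fun α => X - C α).prod.eval z‖ := by
  induction s using Multiset.induction with
  | empty =>
    refine ⟨1, 0, 0, one_pos, ⟨by simp, by simp, fun n => ?_, fun n hn => ?_⟩, ?_⟩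
    · rcases eq_or_ne n 0 with rfl | hn <;> simp [coeff_one, *]
    · have : n ≠ 0 := by omega
      simp [coeff_one, this]
    · simp
  | cons α s ih =>
    obtain ⟨g, i, d, hg, hw, hev⟩ := ih
    simp only [Multiset.map_cons, Multiset.prod_cons, mul_comm (X - C α), eval_mul, eval_sub,
      eval_X, eval_C, norm_mul]
    rcases lt_trichotomy ‖α‖ 1 with hα | hα | hα
    · refine ⟨g, i + 1, d, hg, hw.mul_X_sub_C_of_lt hg hα, fun z δ hz hδ h => ?_⟩
      rw [ultra_norm_sub_eq_left (by rwa [hz]), hz, mul_one]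
      exact hev z δ hz hδ fun β hβ => h β (Multiset.mem_cons_of_mem hβ)
    · refine ⟨g, i, d + 1, hg, hw.mul_X_sub_C_of_eq hα, fun z δ hz hδ h => ?_⟩
      rw [pow_succ, ← mul_assoc, norm_sub_rev z]
      exact mul_le_mul (hev z δ hz hδ fun β hβ => h β (Multiset.mem_cons_of_mem hβ))
        (h α (Multiset.mem_cons_self _ _) hα) hδ (norm_nonneg _)
    · refine ⟨g * ‖α‖, i, d, by positivity, hw.mul_X_sub_C_of_gt hg hα,
        fun z δ hz hδ h => ?_⟩
      rw [ultra_norm_sub_eq_right (by rwa [hz]), mul_right_comm]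
      exact mul_le_mul_of_nonneg_right
        (hev z δ hz hδ fun β hβ => h β (Multiset.mem_cons_of_mem hβ)) (norm_nonneg _)

/-- A polynomial whose value at a unit `z` is small has a root close to `z`, uniformly in terms of
the width of its Gauss window. -/
lemma GaussWindow.exists_root_near [IsAlgClosed k] {p : k[X]} {g : ℝ} {i d : ℕ}
    (hg : 0 < g) (h : GaussWindow p g i d) {z : k} (hz : ‖z‖ = 1) {δ : ℝ} (hδ : 0 ≤ δ)
    (hev : ‖p.eval z‖ < g * δ ^ d) : ∃ α, p.eval α = 0 ∧ ‖α‖ = 1 ∧ ‖α - z‖ < δ := by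
  by_contra! hno
  have hp : p ≠ 0 := by
    rintro rfl
    exact hg.ne (by simpa using h.1)
  have hfac := (IsAlgClosed.splits p).eq_prod_roots
  obtain ⟨g', i', d', hg', hw, hb⟩ := exists_gaussWindow_prod_X_sub_C p.roots
  have hw' := hw.C_mul (leadingCoeff_ne_zero.2 hp)
  rw [← hfac] at hw'
  obtain ⟨rfl, rfl, rfl⟩ := h.unique hw'
  have := hb z δ hz hδ fun α hα h1 => hno α (isRoot_of_mem_roots hα) h1
  have he : p.eval z = p.leadingCoeff * (p.roots.map fun α => X - C α).prod.eval z := by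
    conv_lhs => rw [hfac]
    rw [eval_mul, eval_C]
  rw [he, norm_mul, mul_assoc] at hev
  exact absurd (lt_of_mul_lt_mul_left hev (norm_nonneg _)) this.not_gt

end GaussWindow

section UnitCircle

open Polynomial Filter Topology

variable {k : Type*} [NormedField k]

lemma norm_mul_zpow_of_unit (c : k) {z : k} (hz : ‖z‖ = 1) (n : ℤ) :
    ‖c * z ^ n‖ = ‖c‖ := by
  rw [norm_mul, norm_zpow, hz, one_zpow, mul_one]

variable [IsUltrametricDist k]

lemma norm_pow_sub_pow_le_of_unit {z w : k} (hz : ‖z‖ = 1) (hw : ‖w‖ = 1) (n : ℕ) :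
    ‖z ^ n - w ^ n‖ ≤ ‖z - w‖ := by
  induction n with
  | zero => simp
  | succ n ih =>
    have : z ^ (n + 1) - w ^ (n + 1) = (z ^ n - w ^ n) * z - w ^ n * (w - z) := by ring
    rw [this]
    apply ultra_norm_sub_le
    · rwa [norm_mul, hz, mul_one]
    · rw [norm_mul, norm_pow, hw, one_pow, one_mul, norm_sub_rev]

lemma norm_zpow_sub_zpow_le_of_unit {z w : k} (hz : ‖z‖ = 1) (hw : ‖w‖ = 1) (n : ℤ) :
    ‖z ^ n - w ^ n‖ ≤ ‖z - w‖ := by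
  have hz0 : z ≠ 0 := norm_ne_zero_iff.1 (by rw [hz]; exact one_ne_zero)
  have hw0 : w ≠ 0 := norm_ne_zero_iff.1 (by rw [hw]; exact one_ne_zero)
  obtain ⟨m, rfl | rfl⟩ := n.eq_nat_or_neg
  · simpa using norm_pow_sub_pow_le_of_unit hz hw m
  · rw [zpow_neg, zpow_neg, zpow_natCast, zpow_natCast,
      inv_sub_inv (pow_ne_zero _ hz0) (pow_ne_zero _ hw0), norm_div, norm_mul, norm_pow, norm_pow,
      hz, hw, one_pow, mul_one, div_one, norm_sub_rev]
    exact norm_pow_sub_pow_le_of_unit hz hw m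

variable [CompleteSpace k]

lemma summable_mul_zpow_of_tendsto {a : ℤ → k} {z : k}
    (ha : Tendsto (fun n => ‖a n‖ * ‖z‖ ^ n) cofinite (𝓝 0)) :
    Summable fun n : ℤ => a n * z ^ n := by
  have := IsUltrametricDist.nonarchimedeanAddGroup (M := k)
  apply NonarchimedeanAddGroup.summable_of_tendsto_cofinite_zero
  rw [tendsto_zero_iff_norm_tendsto_zero]
  simpa [norm_mul, norm_zpow] using ha

lemma summable_mul_zpow_of_unit {b : ℤ → k} (hb : Tendsto (fun n => ‖b n‖) cofinite (𝓝 0))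
    {z : k} (hz : ‖z‖ = 1) : Summable fun n : ℤ => b n * z ^ n :=
  summable_mul_zpow_of_tendsto (by simpa [hz] using hb)

lemma norm_tsum_mul_zpow_sub_le {b : ℤ → k}
    (hb : Tendsto (fun n => ‖b n‖) cofinite (𝓝 0)) (hle : ∀ n, ‖b n‖ ≤ 1)
    {z w : k} (hz : ‖z‖ = 1) (hw : ‖w‖ = 1) :
    ‖(∑' n : ℤ, b n * z ^ n) - ∑' n : ℤ, b n * w ^ n‖ ≤ ‖z - w‖ := by
  rw [← (summable_mul_zpow_of_unit hb hz).tsum_sub (summable_mul_zpow_of_unit hb hw)]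
  refine IsUltrametricDist.norm_tsum_le_of_forall_le_of_nonneg (norm_nonneg _) fun n => ?_
  rw [← mul_sub, norm_mul]
  exact (mul_le_of_le_one_left (norm_nonneg _) (hle n)).trans
    (norm_zpow_sub_zpow_le_of_unit hz hw n)

variable [IsAlgClosed k]

lemma exists_near_norm_tsum_lt {b : ℤ → k}
    (hb : Tendsto (fun n => ‖b n‖) cofinite (𝓝 0)) (hle : ∀ n, ‖b n‖ ≤ 1) {i : ℤ} {d : ℕ}
    (hi : ‖b i‖ = 1) (hj : ‖b (i + d)‖ = 1) (hout : ∀ n, n < i ∨ i + d < n → ‖b n‖ < 1)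
    {z : k} (hz : ‖z‖ = 1) {δ : ℝ} (hδ : 0 ≤ δ) (hF : ‖∑' n : ℤ, b n * z ^ n‖ < δ ^ d)
    {ε : ℝ} (hε : 0 < ε) :
    ∃ w : k, ‖w‖ = 1 ∧ ‖∑' n : ℤ, b n * w ^ n‖ < ε ∧ ‖w - z‖ < δ := by
  have hδd : 0 < δ ^ d := (norm_nonneg _).trans_lt hF
  obtain ⟨η, hη, hηlt⟩ := exists_between (lt_min hε hδd)
  have hfin : {n | ¬ ‖b n‖ < η}.Finite := hb.eventually (gt_mem_nhds hη)
  let S : Finset ℤ := hfin.toFinset ∪ {i, i + d}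
  have hS : ∀ n, n ∉ S → ‖b n‖ < η := by
    intro n hn
    by_contra h
    exact hn (by simp only [S, Finset.mem_union, Set.Finite.mem_toFinset]; exact Or.inl h)
  have hiS : i ∈ S := by simp [S]
  have hjS : i + d ∈ S := by simp [S]
  have htail : ∀ w : k, ‖w‖ = 1 →
      ‖(∑' n : ℤ, b n * w ^ n) - ∑ n ∈ S, b n * w ^ n‖ ≤ η := by
    intro w hw
    rw [← (summable_mul_zpow_of_unit hb hw).sum_add_tsum_compl (s := S), add_sub_cancel_left]
    refine IsUltrametricDist.norm_tsum_le_of_forall_le_of_nonneg hη.le fun n => ?_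
    rw [norm_mul_zpow_of_unit _ hw]
    exact (hS n fun h => n.2 (Finset.mem_coe.2 h)).le
  obtain ⟨N, hN⟩ : ∃ N : ℤ, ∀ n ∈ S, 0 ≤ n + N := by
    obtain ⟨m, hm⟩ := S.bddBelow
    exact ⟨-m, fun n hn => by have := hm hn; omega⟩
  let P : k[X] := ∑ n ∈ S, C (b n) * X ^ (n + N).toNat
  have hcoeff : ∀ m : ℕ, P.coeff m = if (m : ℤ) - N ∈ S then b (m - N) else 0 := by
    intro m
    simp only [P, finsetSum_coeff, coeff_C_mul, coeff_X_pow, mul_ite, mul_one, mul_zero]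
    rw [← Finset.sum_ite_eq' S ((m : ℤ) - N) b]
    refine Finset.sum_congr rfl fun n hn => ?_
    have := hN n hn
    congr 1
    exact propext ⟨fun h => by omega, fun h => by omega⟩
  have heval : ∀ w : k, ‖w‖ = 1 → P.eval w = w ^ N * ∑ n ∈ S, b n * w ^ n := by
    intro w hw
    have hw0 : w ≠ 0 := norm_ne_zero_iff.1 (by rw [hw]; exact one_ne_zero)
    simp only [P, eval_finsetSum, eval_mul, eval_C, eval_pow, eval_X, Finset.mul_sum]
    refine Finset.sum_congr rfl fun n hn => ?_
    rw [← zpow_natCast, Int.toNat_of_nonneg (hN n hn), zpow_add₀ hw0]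
    ring
  have hiN := hN i hiS
  have hwin : GaussWindow P 1 (i + N).toNat d := by
    refine ⟨?_, ?_, fun n => ?_, fun n hn => ?_⟩
    · have : ((i + N).toNat : ℤ) - N = i := by omega
      rw [hcoeff, this, if_pos hiS, hi]
    · have : (((i + N).toNat + d : ℕ) : ℤ) - N = i + d := by omega
      rw [hcoeff, this, if_pos hjS, hj]
    · rw [hcoeff]
      split_ifs
      · exact hle _
      · simp
    · rw [hcoeff]
      split_ifs
      · exact hout _ (by omega)
      · simp
  have hPz : ‖P.eval z‖ < 1 * δ ^ d := by
    rw [heval z hz, norm_mul, norm_zpow, hz, one_zpow, one_mul, one_mul]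
    have := ultra_norm_sub_lt hF ((htail z hz).trans_lt (hηlt.trans_le (min_le_right _ _)))
    rwa [sub_sub_cancel] at this
  obtain ⟨w, hw0, hw, hwz⟩ := hwin.exists_root_near one_pos hz hδ hPz
  refine ⟨w, hw, ?_, hwz⟩
  have hne : w ≠ 0 := norm_ne_zero_iff.1 (by rw [hw]; exact one_ne_zero)
  rw [heval w hw, mul_eq_zero, or_iff_right (zpow_ne_zero _ hne)] at hw0
  have := (htail w hw).trans_lt (hηlt.trans_le (min_le_left _ _))
  rwa [hw0, sub_zero] at this

/-- A Laurent series on the unit circle whose Gauss norm is attained at two different degrees has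
a zero on the unit circle. -/
lemma exists_unit_tsum_eq_zero {b : ℤ → k}
    (hb : Tendsto (fun n => ‖b n‖) cofinite (𝓝 0)) (hle : ∀ n, ‖b n‖ ≤ 1) {i : ℤ} {d : ℕ}
    (hd : d ≠ 0) (hi : ‖b i‖ = 1) (hj : ‖b (i + d)‖ = 1)
    (hout : ∀ n, n < i ∨ i + d < n → ‖b n‖ < 1) :
    ∃ z : k, ‖z‖ = 1 ∧ ∑' n : ℤ, b n * z ^ n = 0 := by
  let F : k → k := fun z => ∑' n : ℤ, b n * z ^ n
  let Q : ℕ → k → Prop := fun m z => ‖z‖ = 1 ∧ ‖F z‖ < (2 * (1 / 2 : ℝ) ^ m) ^ d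
  have hstep : ∀ m z, Q m z → ∃ w, Q (m + 1) w ∧ dist z w ≤ 2 * (1 / 2 : ℝ) ^ m := by
    intro m z hz
    obtain ⟨w, h1, h2, h3⟩ := exists_near_norm_tsum_lt hb hle hi hj hout hz.1 (by positivity) hz.2
      (ε := (2 * (1 / 2 : ℝ) ^ (m + 1)) ^ d) (by positivity)
    exact ⟨w, ⟨h1, h2⟩, by rw [dist_comm, dist_eq_norm]; exact h3.le⟩
  have h0 : Q 0 1 := by
    refine ⟨norm_one, ?_⟩
    have : ‖F 1‖ ≤ 1 := by
      refine IsUltrametricDist.norm_tsum_le_of_forall_le_of_nonneg zero_le_one fun n => ?_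
      rw [norm_mul_zpow_of_unit _ norm_one]
      exact hle n
    refine this.trans_lt ?_
    rw [pow_zero, mul_one]
    exact one_lt_pow₀ one_lt_two hd
  choose! f hfQ hfd using hstep
  let u : ℕ → k := fun n => Nat.rec 1 f n
  have huQ : ∀ n, Q n (u n) := by
    intro n
    induction n with
    | zero => exact h0
    | succ n ih => exact hfQ n _ ih
  have hcauchy : CauchySeq u :=
    cauchySeq_of_le_geometric (1 / 2) 2 (by norm_num) fun n => hfd n _ (huQ n)
  obtain ⟨z, hz⟩ := cauchySeq_tendsto_of_complete hcauchy
  have hz1 : ‖z‖ = 1 := by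
    refine tendsto_nhds_unique hz.norm ?_
    simp only [(huQ _).1]
    exact tendsto_const_nhds
  refine ⟨z, hz1, ?_⟩
  have hFz : Tendsto (fun n => F (u n)) atTop (𝓝 (F z)) := by
    rw [tendsto_iff_norm_sub_tendsto_zero]
    exact squeeze_zero (fun _ => norm_nonneg _)
      (fun n => norm_tsum_mul_zpow_sub_le hb hle (huQ n).1 hz1)
      (tendsto_iff_norm_sub_tendsto_zero.1 hz)
  have hF0 : Tendsto (fun n => F (u n)) atTop (𝓝 0) := by
    refine squeeze_zero_norm (fun n => (huQ n).2.le) ?_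
    have : Tendsto (fun n : ℕ => (2 * (1 / 2 : ℝ) ^ n) ^ d) atTop (𝓝 ((2 * 0) ^ d)) :=
      ((tendsto_pow_atTop_nhds_zero_of_lt_one (by norm_num) (by norm_num)).const_mul 2).pow d
    simpa [hd] using this
  exact tendsto_nhds_unique hFz hF0

end UnitCircle

section Annulus

open Filter Topology

lemma exists_forall_le_of_tendsto_cofinite {ι : Type*} [Nonempty ι] {f : ι → ℝ}
    (h0 : ∀ n, 0 ≤ f n) (hf : Tendsto f cofinite (𝓝 0)) : ∃ m, ∀ n, f n ≤ f m := by
  by_cases h : ∃ l, 0 < f l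
  · obtain ⟨l, hl⟩ := h
    have hfin : {n | ¬ f n < f l}.Finite := hf.eventually (gt_mem_nhds hl)
    obtain ⟨m, hm, hmax⟩ := hfin.exists_maximalFor f _ ⟨l, lt_irrefl (f l)⟩
    refine ⟨m, fun n => ?_⟩
    by_cases hn : f n < f l
    · exact hn.le.trans (not_lt.1 hm)
    · exact (le_total (f n) (f m)).elim id fun h => hmax hn h
  · push Not at h
    exact ⟨Classical.arbitrary ι, fun n => (h n).trans (h0 _)⟩

variable {k : Type*} [NormedField k]

/-- If the Gauss norm of radius `r` of a Laurent series is attained at two different degrees, then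
the series has a zero of norm `r`. -/
lemma exists_tsum_eq_zero_of_tie [IsUltrametricDist k] [CompleteSpace k] [IsAlgClosed k]
    {a : ℤ → k} {r : ℝ} (hr : 0 < r)
    (ha : Tendsto (fun n => ‖a n‖ * r ^ n) cofinite (𝓝 0)) {m n : ℤ} (hmn : m ≠ n)
    (hpos : 0 < ‖a m‖ * r ^ m) (hmax : ∀ l, ‖a l‖ * r ^ l ≤ ‖a m‖ * r ^ m)
    (htie : ‖a n‖ * r ^ n = ‖a m‖ * r ^ m) :
    ∃ z : k, ‖z‖ = r ∧ ∑' n : ℤ, a n * z ^ n = 0 := by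
  set G := ‖a m‖ * r ^ m with hG
  have hfin : {l | ¬ ‖a l‖ * r ^ l < G}.Finite := ha.eventually (gt_mem_nhds hpos)
  have hmem : ∀ l, l ∈ hfin.toFinset ↔ ‖a l‖ * r ^ l = G := fun l => by
    simp only [Set.Finite.mem_toFinset, Set.mem_ofPred_eq, not_lt]
    exact ⟨fun h => (hmax l).antisymm h, fun h => h.ge⟩
  have hmM := (hmem m).2 rfl
  have hnM := (hmem n).2 htie
  have hneM : hfin.toFinset.Nonempty := ⟨m, hmM⟩
  obtain ⟨i, hi⟩ : ∃ i, i = hfin.toFinset.min' hneM := ⟨_, rfl⟩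
  obtain ⟨j, hj⟩ : ∃ j, j = hfin.toFinset.max' hneM := ⟨_, rfl⟩
  have hiG : ‖a i‖ * r ^ i = G := (hmem i).1 (hi ▸ Finset.min'_mem _ _)
  have hjG : ‖a j‖ * r ^ j = G := (hmem j).1 (hj ▸ Finset.max'_mem _ _)
  have hile : ∀ l, ‖a l‖ * r ^ l = G → i ≤ l := fun l hl =>
    hi ▸ Finset.min'_le _ _ ((hmem l).2 hl)
  have hjle : ∀ l, ‖a l‖ * r ^ l = G → l ≤ j := fun l hl =>
    hj ▸ Finset.le_max' _ _ ((hmem l).2 hl)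
  have hij : i < j := by
    have := hile m rfl
    have := hile n htie
    have := hjle m rfl
    have := hjle n htie
    omega
  obtain ⟨d, rfl⟩ : ∃ d : ℕ, j = i + d := ⟨(j - i).toNat, by omega⟩
  have hd : d ≠ 0 := by omega
  have hai : 0 < ‖a i‖ := pos_of_mul_pos_left (hiG ▸ hpos) (zpow_pos hr _).le
  have haj : 0 < ‖a (i + d)‖ := pos_of_mul_pos_left (hjG ▸ hpos) (zpow_pos hr _).le
  obtain ⟨c, hc⟩ := IsAlgClosed.exists_pow_nat_eq (a i / a (i + d)) (Nat.pos_of_ne_zero hd)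
  have hcr : ‖c‖ = r := by
    rw [← pow_left_inj₀ (norm_nonneg c) hr.le hd, ← norm_pow, hc, norm_div, div_eq_iff haj.ne']
    have h := hiG.trans hjG.symm
    rw [zpow_add₀ hr.ne', zpow_natCast] at h
    have hri := zpow_pos hr i
    apply mul_right_cancel₀ hri.ne'
    linear_combination h
  have hc0 : c ≠ 0 := norm_ne_zero_iff.1 (by rw [hcr]; exact hr.ne')
  set A := a i * c ^ i with hA
  have hAn : ‖A‖ = G := by rw [hA, norm_mul, norm_zpow, hcr, hiG]
  have hA0 : A ≠ 0 := norm_ne_zero_iff.1 (by rw [hAn]; exact hpos.ne')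
  let b : ℤ → k := fun l => a l * c ^ l / A
  have hb : ∀ l, ‖b l‖ = ‖a l‖ * r ^ l / G := fun l => by
    simp only [b, norm_div, norm_mul, norm_zpow, hcr, hAn]
  obtain ⟨z, hz, hz0⟩ := exists_unit_tsum_eq_zero (b := b) (i := i) (d := d)
    (by simpa [hb] using ha.div_const G)
    (fun l => by rw [hb]; exact div_le_one_of_le₀ (hmax l) hpos.le)
    hd (by rw [hb, hiG, div_self hpos.ne']) (by rw [hb, hjG, div_self hpos.ne'])
    (fun l hl => by
      rw [hb, div_lt_one hpos]
      refine (hmax l).lt_of_ne fun h => ?_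
      have := hile l h
      have := hjle l h
      omega)
  refine ⟨c * z, by rw [norm_mul, hcr, hz, mul_one], ?_⟩
  have : ∀ l : ℤ, a l * (c * z) ^ l = A * (b l * z ^ l) := fun l => by
    simp only [b, mul_zpow]
    field_simp
  simp only [this, tsum_mul_left, hz0, mul_zero]

/-- Strict dominance of one monomial persists, as dominance, for nearby radii. -/
lemma eventually_dominated {a : ℤ → k} {r₁ r₀ r₂ : ℝ} (hr₁ : 0 < r₁) (h₁ : r₁ < r₀)
    (h₂ : r₀ < r₂) (ha₁ : Tendsto (fun n => ‖a n‖ * r₁ ^ n) cofinite (𝓝 0))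
    (ha₂ : Tendsto (fun n => ‖a n‖ * r₂ ^ n) cofinite (𝓝 0)) {m : ℤ}
    (hpos : 0 < ‖a m‖ * r₀ ^ m) (hmax : ∀ n, n ≠ m → ‖a n‖ * r₀ ^ n < ‖a m‖ * r₀ ^ m) :
    ∀ᶠ r in 𝓝 r₀, ∀ n, ‖a n‖ * r ^ n ≤ ‖a m‖ * r ^ m := by
  have hcont : ∀ n : ℤ, ContinuousAt (fun r : ℝ => ‖a n‖ * r ^ n) r₀ := fun n =>
    continuousAt_const.mul (continuousAt_zpow₀ _ _ (Or.inl (hr₁.trans h₁).ne'))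
  obtain ⟨g, hg, hgm⟩ := exists_between hpos
  have hsum := ha₁.add ha₂
  rw [add_zero] at hsum
  have hfin : {n | ¬ ‖a n‖ * r₁ ^ n + ‖a n‖ * r₂ ^ n < g}.Finite :=
    hsum.eventually (gt_mem_nhds hg)
  have hnear : ∀ᶠ r in 𝓝 r₀, ∀ n ∈ {n | ¬ ‖a n‖ * r₁ ^ n + ‖a n‖ * r₂ ^ n < g},
      ‖a n‖ * r ^ n ≤ ‖a m‖ * r ^ m := by
    rw [eventually_all_finite hfin]
    intro n _
    rcases eq_or_ne n m with rfl | hn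
    · exact Eventually.of_forall fun _ => le_rfl
    · exact ((hcont n).eventually_lt (hcont m) (hmax n hn)).mono fun _ h => h.le
  filter_upwards [hnear, (hcont m).eventually (lt_mem_nhds hgm), Ioo_mem_nhds h₁ h₂]
    with r hr hgr hrI n
  by_cases hn : ‖a n‖ * r₁ ^ n + ‖a n‖ * r₂ ^ n < g
  · have hr0 : 0 < r := hr₁.trans hrI.1
    have hpow : r ^ n ≤ r₁ ^ n + r₂ ^ n := by
      have p1 := zpow_pos hr₁ n
      have p2 := zpow_pos (hr0.trans hrI.2) n
      rcases le_total 0 n with h | h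
      · linarith [zpow_le_zpow_left₀ h hr0.le hrI.2.le]
      · have h' := zpow_le_zpow_left₀ (neg_nonneg.2 h) hr₁.le hrI.1.le
        rw [zpow_neg, zpow_neg, inv_le_inv₀ p1 (zpow_pos hr0 n)] at h'
        linarith
    have := mul_le_mul_of_nonneg_left hpow (norm_nonneg (a n))
    linarith
  · exact hr n hn

lemma norm_tsum_eq_of_strict_max [IsUltrametricDist k] [CompleteSpace k]
    {a : ℤ → k} {z : k} (ha : Tendsto (fun n => ‖a n‖ * ‖z‖ ^ n) cofinite (𝓝 0)) {m : ℤ}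
    (hpos : 0 < ‖a m‖ * ‖z‖ ^ m) (hmax : ∀ n, n ≠ m → ‖a n‖ * ‖z‖ ^ n < ‖a m‖ * ‖z‖ ^ m) :
    ‖∑' n : ℤ, a n * z ^ n‖ = ‖a m‖ * ‖z‖ ^ m := by
  have hs := summable_mul_zpow_of_tendsto ha
  let t : ℤ → k := fun n => if n = m then 0 else a n * z ^ n
  have htn : ∀ n, ‖t n‖ ≤ ‖a n‖ * ‖z‖ ^ n := fun n => by
    simp only [t]
    split_ifs
    · rw [norm_zero]
      positivity
    · rw [norm_mul, norm_zpow]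
  obtain ⟨l, hl⟩ := exists_forall_le_of_tendsto_cofinite (f := fun n => ‖t n‖)
    (fun _ => norm_nonneg _) (squeeze_zero (fun _ => norm_nonneg _) htn ha)
  have hlt : ‖t l‖ < ‖a m * z ^ m‖ := by
    rw [norm_mul, norm_zpow]
    rcases eq_or_ne l m with rfl | h
    · simpa [t] using hpos
    · exact (htn l).trans_lt (hmax l h)
  have htail : ‖∑' n, t n‖ < ‖a m * z ^ m‖ :=
    (IsUltrametricDist.norm_tsum_le_of_forall_le_of_nonneg (norm_nonneg _) hl).trans_lt hlt
  rw [hs.tsum_eq_add_tsum_ite m,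
    IsUltrametricDist.norm_add_eq_max_of_norm_ne_norm htail.ne', max_eq_left htail.le,
    norm_mul, norm_zpow]

end Annulus

theorem annulus_nonvanishing_monomial_dominated
    {k : Type*} [NontriviallyNormedField k] [CompleteSpace k]
    [IsUltrametricDist k] [IsAlgClosed k]
    (ρ : ℝ) (hρ0 : 0 < ρ) (hρ1 : ρ < 1)
    (a : ℤ → k)
    (hconv : ∀ r : ℝ, ρ < r → r < 1 →
      Filter.Tendsto (fun n : ℤ => ‖a n‖ * r ^ n) Filter.cofinite (nhds 0))
    (hne : ∃ n, a n ≠ 0)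
    (hF : ∀ z : k, ρ < ‖z‖ → ‖z‖ < 1 → (∑' n : ℤ, a n * z ^ n) ≠ 0) :
    ∃ n₀ : ℤ,
      (∀ r : ℝ, ρ < r → r < 1 → ∀ n : ℤ, ‖a n‖ * r ^ n ≤ ‖a n₀‖ * r ^ n₀) ∧
      ∀ z : k, ρ < ‖z‖ → ‖z‖ < 1 →
        ‖∑' n : ℤ, a n * z ^ n‖ = ‖a n₀‖ * ‖z‖ ^ n₀ := by
  have hpos0 : ∀ r, ρ < r → 0 < r := fun r h => hρ0.trans h
  have hmaxpos : ∀ r, ρ < r → ∀ m, (∀ n, ‖a n‖ * r ^ n ≤ ‖a m‖ * r ^ m) →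
      0 < ‖a m‖ * r ^ m := by
    intro r hr m hm
    obtain ⟨n, hn⟩ := hne
    exact (mul_pos (norm_pos_iff.2 hn) (zpow_pos (hpos0 r hr) n)).trans_le (hm n)
  have hstrict : ∀ r, ρ < r → r < 1 → ∀ m, (∀ n, ‖a n‖ * r ^ n ≤ ‖a m‖ * r ^ m) →
      ∀ n, n ≠ m → ‖a n‖ * r ^ n < ‖a m‖ * r ^ m := by
    intro r hr hr1 m hm n hnm
    refine (hm n).lt_of_ne fun htie => ?_
    obtain ⟨z, rfl, hz0⟩ := exists_tsum_eq_zero_of_tie (hpos0 r hr) (hconv r hr hr1) hnm.symm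
      (hmaxpos r hr m hm) hm htie
    exact hF z hr hr1 hz0
  let U : ℤ → Set ℝ := fun m => {r | ∀ n, ‖a n‖ * r ^ n ≤ ‖a m‖ * r ^ m}
  have hcover : ∀ r ∈ Set.Ioo ρ 1, ∃ m, r ∈ U m := fun r hr =>
    exists_forall_le_of_tendsto_cofinite
      (fun n => mul_nonneg (norm_nonneg _) (zpow_pos (hpos0 r hr.1) n).le) (hconv r hr.1 hr.2)
  have hnhds : ∀ m, ∀ r ∈ Set.Ioo ρ 1, r ∈ U m → r ∈ interior (U m) := by
    intro m r hr hrm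
    obtain ⟨r₁, hr₁, h₁⟩ := exists_between hr.1
    obtain ⟨r₂, h₂, hr₂⟩ := exists_between hr.2
    exact mem_interior_iff_mem_nhds.2 (eventually_dominated (hpos0 r₁ hr₁) h₁ h₂
      (hconv r₁ hr₁ (h₁.trans hr.2)) (hconv r₂ (hr.1.trans h₂) hr₂) (hmaxpos r hr.1 m hrm)
      (hstrict r hr.1 hr.2 m hrm))
  obtain ⟨s, hs⟩ := exists_between hρ1
  obtain ⟨n₀, hn₀⟩ := hcover s hs
  have hdisj : Set.Ioo ρ 1 ∩ (interior (U n₀) ∩ ⋃ m ≠ n₀, interior (U m)) = ∅ := by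
    ext r
    simp only [Set.mem_inter_iff, Set.mem_iUnion, Set.mem_empty_iff_false, iff_false]
    rintro ⟨hr, h0, m, hm, hrm⟩
    exact (hstrict r hr.1 hr.2 n₀ (interior_subset h0) m hm).not_ge (interior_subset hrm n₀)
  have hall : ∀ r ∈ Set.Ioo ρ 1, r ∈ U n₀ := by
    rcases isPreconnected_iff_subset_of_disjoint.1 (isPreconnected_Ioo (a := ρ) (b := 1)) _ _
      isOpen_interior (isOpen_biUnion fun m (_ : m ≠ n₀) => isOpen_interior (s := U m))
      (fun r hr => by
        obtain ⟨m, hm⟩ := hcover r hr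
        rcases eq_or_ne m n₀ with rfl | h
        · exact Or.inl (hnhds m r hr hm)
        · exact Or.inr (Set.mem_biUnion h (hnhds m r hr hm))) hdisj with h | h
    · exact fun r hr => interior_subset (h hr)
    · have : s ∈ Set.Ioo ρ 1 ∩ (interior (U n₀) ∩ ⋃ m ≠ n₀, interior (U m)) :=
        ⟨hs, hnhds n₀ s hs hn₀, h hs⟩
      rw [hdisj] at this
      exact this.elim
  refine ⟨n₀, fun r hr hr1 => hall r ⟨hr, hr1⟩, fun z hz hz1 => ?_⟩
  have hz' := hall ‖z‖ ⟨hz, hz1⟩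
  exact norm_tsum_eq_of_strict_max (hconv _ hz hz1) (hmaxpos _ hz _ hz')
    (hstrict _ hz hz1 _ hz')
end

section
/- The Fubini–Study derivative is bounded by the Lipschitz ratio for the projective distance: Let f_0, …, f_N : D(k) → k be functions on the open unit disk D(k) = {z ∈ k : |z| < 1} that are differentiable at every point of D(k) and have no common zero on D(k). Then sup_{z ∈ D(k)} |f'(z)| ≤ sup_{z, y ∈ D(k), z ≠ y} d_P(f(z), f(y)) / |z − y|, where |f'(z)| is the Fubini–Study derivative of the tuple f = (f_0, …, f_N) at z and d_P is the projective distance applied to the vectors (f_0(z),…,f_N(z)) and (f_0(y),…,f_N(y)). -/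
/-!
The Fubini–Study derivative is bounded by the Lipschitz ratio for the
projective distance.

Let `f 0, …, f N` be functions on the open unit disk `{z : ‖z‖ < 1}` of `k`,
differentiable at every point of the disk (with derivatives `f' i z`) and with
no common zero on the disk.  Then
`sup_{‖z‖<1} |f'(z)| ≤ sup_{z ≠ y} d_P(f z, f y) / ‖z - y‖`,
where `|f'(z)|` is the Fubini–Study derivative and `d_P` the projective
distance.  The suprema are taken in `ℝ≥0∞` (via `ENNReal.ofReal`) since the
right-hand side need not be finite a priori.
-/

/-- The projective distance between two vectors of `k^{N+1}`, computed in
homogeneous coordinates. -/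
noncomputable def projDist {k : Type*} [NontriviallyNormedField k] {N : ℕ}
    (x y : Fin (N + 1) → k) : ℝ :=
  (⨆ p : Fin (N + 1) × Fin (N + 1), ‖x p.1 * y p.2 - x p.2 * y p.1‖) /
    ((⨆ i, ‖x i‖) * ⨆ j, ‖y j‖)

theorem ciSup_norm_eq_pi_norm {ι E : Type*} [Fintype ι] [Nonempty ι] [SeminormedAddCommGroup E]
    (x : ι → E) : (⨆ i, ‖x i‖) = ‖x‖ :=
  le_antisymm (ciSup_le fun i => norm_le_pi_norm x i)
    ((pi_norm_le_iff_of_nonempty x).2 fun i => le_ciSup (Set.finite_range fun i => ‖x i‖).bddAbove i)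

/-- The difference quotients of the projective distance along a tuple of functions differentiable
at a point of the unit disk converge to the Fubini–Study derivative. -/
theorem tendsto_projDist_div_fsDeriv {k : Type*} [NontriviallyNormedField k] {N : ℕ}
    {f f' : Fin (N + 1) → k → k} {z : k} (hz : ‖z‖ ≤ 1)
    (hf : ∀ i, HasDerivAt (f i) (f' i z) z) (hne : ∃ i, f i z ≠ 0) :
    Filter.Tendsto (fun y => projDist (fun i => f i z) (fun i => f i y) / ‖z - y‖)
      (nhdsWithin z {z}ᶜ) (nhds (fsDeriv f f' z)) := by
  have hF : (fun i => f i z) ≠ 0 := fun h => hne.elim fun i hi => hi (congrFun h i)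
  have hcont : Filter.Tendsto (fun y => ‖fun i => f i y‖) (nhdsWithin z {z}ᶜ)
      (nhds ‖fun i => f i z‖) :=
    (tendsto_pi_nhds.2 fun i => (hf i).continuousAt.tendsto.mono_left nhdsWithin_le_nhds).norm
  have hwedge : HasDerivAt
      (fun y (p : Fin (N + 1) × Fin (N + 1)) => f p.1 z * f p.2 y - f p.2 z * f p.1 y)
      (fun p => f p.1 z * f' p.2 z - f p.2 z * f' p.1 z) z :=
    hasDerivAt_pi.2 fun p => ((hf p.2).const_mul _).sub ((hf p.1).const_mul _)
  have hlim := (hasDerivAt_iff_tendsto_slope.1 hwedge).norm.div (hcont.const_mul ‖fun i => f i z‖)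
    (mul_ne_zero (norm_ne_zero_iff.2 hF) (norm_ne_zero_iff.2 hF))
  have hvalue : fsDeriv f f' z = ‖fun p : Fin (N + 1) × Fin (N + 1) =>
      f p.1 z * f' p.2 z - f p.2 z * f' p.1 z‖ / (‖fun i => f i z‖ * ‖fun i => f i z‖) := by
    rw [fsDeriv, max_eq_left (pow_le_one₀ (norm_nonneg z) hz), one_mul, sq,
      ciSup_norm_eq_pi_norm, ciSup_norm_eq_pi_norm, ← norm_neg]
    congr 2
    ext p
    simp only [Pi.neg_apply]
    ring
  rw [hvalue]
  refine hlim.congr fun y => ?_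
  have hzero : (fun p : Fin (N + 1) × Fin (N + 1) => f p.1 z * f p.2 z - f p.2 z * f p.1 z) = 0 := by
    ext p
    simp [mul_comm]
  rw [projDist, ciSup_norm_eq_pi_norm, ciSup_norm_eq_pi_norm, ciSup_norm_eq_pi_norm]
  simp only [Pi.div_apply, slope_def_module, hzero, sub_zero, norm_smul, norm_inv]
  rw [norm_sub_rev y z]
  ring

theorem fubiniStudy_deriv_le_lipschitz_ratio
    {k : Type*} [NontriviallyNormedField k] [CompleteSpace k]
    [IsUltrametricDist k]
    (N : ℕ) (f f' : Fin (N + 1) → k → k)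
    (hdiff : ∀ i, ∀ z : k, ‖z‖ < 1 → HasDerivAt (f i) (f' i z) z)
    (hnz : ∀ z : k, ‖z‖ < 1 → ∃ i, f i z ≠ 0) :
    (⨆ z : {z : k // ‖z‖ < 1}, ENNReal.ofReal (fsDeriv f f' z))
      ≤ ⨆ (z : {z : k // ‖z‖ < 1}) (y : {y : k // ‖y‖ < 1})
          (_ : (z : k) ≠ (y : k)),
          ENNReal.ofReal
            (projDist (fun i => f i z) (fun i => f i y) / ‖(z : k) - (y : k)‖) := by
  refine iSup_le fun z => ?_
  have hlim := ENNReal.tendsto_ofReal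
    (tendsto_projDist_div_fsDeriv z.2.le (fun i => hdiff i z z.2) (hnz z z.2))
  refine le_of_tendsto hlim ?_
  have hball : ∀ᶠ y : k in nhdsWithin (z : k) {(z : k)}ᶜ, ‖y‖ < 1 :=
    nhdsWithin_le_nhds (continuous_norm.continuousAt.eventually_lt_const z.2)
  filter_upwards [hball, self_mem_nhdsWithin] with y hy hyz
  exact le_iSup_of_le z (le_iSup_of_le ⟨y, hy⟩ (le_iSup_of_le (Ne.symm hyz) le_rfl))
end

section
/- The Fubini–Study derivative is the infinitesimal dilation of the projective distance: Let x ∈ k with |x| < 1 and let f_0, …, f_N : k → k be differentiable at x with not all f_i(x) = 0. Then the quotient d_P(f(x), f(y)) / |y − x| tends, as y → x with y ≠ x, to the Fubini–Study derivative |f'(x)| of the tuple f = (f_0, …, f_N) at x (here d_P is applied to the vectors (f_0(x),…,f_N(x)) and (f_0(y),…,f_N(y)), and since |x| < 1 the factor max{1,|x|²} in the definition of |f'(x)| equals 1). -/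
/-- Finite suprema of real functions commute with limits. -/
theorem tendsto_ciSup_of_finite {α ι : Type*} [Fintype ι] [Nonempty ι] {l : Filter α}
    {u : ι → α → ℝ} {a : ι → ℝ} (h : ∀ i, Filter.Tendsto (u i) l (nhds (a i))) :
    Filter.Tendsto (fun y => ⨆ i, u i y) l (nhds (⨆ i, a i)) := by
  simp only [← Finset.sup'_univ_eq_ciSup]
  exact Filter.Tendsto.finset_sup'_nhds_apply _ fun i _ => h i

/-- The normalized two-by-two minor of `(f x, f y)` and `(g x, g y)` tends to the Wronskian. -/
theorem HasDerivAt.tendsto_minor_div {k : Type*} [NontriviallyNormedField k] {f g : k → k}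
    {f' g' x : k} (hf : HasDerivAt f f' x) (hg : HasDerivAt g g' x) :
    Filter.Tendsto (fun y => (f x * g y - g x * f y) / (y - x)) (nhdsWithin x {x}ᶜ)
      (nhds (f x * g' - g x * f')) := by
  refine ((hg.tendsto_slope.const_mul (f x)).sub (hf.tendsto_slope.const_mul (g x))).congr
    fun y => ?_
  rw [slope_def_field, slope_def_field]
  ring

theorem projDist_ratio_tendsto_fubiniStudy_deriv
    {k : Type*} [NontriviallyNormedField k] [CompleteSpace k]
    [IsUltrametricDist k]
    (N : ℕ) (x : k) (hx : ‖x‖ < 1)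
    (f : Fin (N + 1) → k → k) (f' : Fin (N + 1) → k)
    (hdiff : ∀ i, HasDerivAt (f i) (f' i) x)
    (hnz : ∃ i, f i x ≠ 0) :
    Filter.Tendsto
      (fun y : k => projDist (fun i => f i x) (fun i => f i y) / ‖y - x‖)
      (nhdsWithin x {x}ᶜ)
      (nhds (max 1 (‖x‖ ^ 2) *
        (⨆ p : Fin (N + 1) × Fin (N + 1),
          ‖f' p.1 * f p.2 x - f' p.2 * f p.1 x‖) / (⨆ i, ‖f i x‖) ^ 2)) := by
  have hM : (⨆ i, ‖f i x‖) ≠ 0 := by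
    obtain ⟨i, hi⟩ := hnz
    exact ((norm_pos_iff.mpr hi).trans_le
      (le_ciSup (f := fun i => ‖f i x‖) (Set.finite_range _).bddAbove i)).ne'
  have hnum := tendsto_ciSup_of_finite fun p : Fin (N + 1) × Fin (N + 1) =>
    ((hdiff p.1).tendsto_minor_div (hdiff p.2)).norm
  have hden := tendsto_ciSup_of_finite fun i =>
    ((hdiff i).continuousAt.tendsto.mono_left (nhdsWithin_le_nhds (s := {x}ᶜ))).norm
  have hmax : max 1 (‖x‖ ^ 2) = 1 := max_eq_left (pow_le_one₀ (norm_nonneg x) hx.le)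
  have hlim := hnum.div (hden.const_mul (⨆ i, ‖f i x‖)) (mul_ne_zero hM hM)
  rw [hmax, one_mul, sq]
  convert hlim using 2
  · rename_i y
    simp only [projDist, div_eq_mul_inv, Pi.div_apply, norm_mul, norm_inv]
    rw [← Real.iSup_mul_of_nonneg (inv_nonneg.mpr (norm_nonneg _)), mul_right_comm]
  · congr 2
    ext p
    rw [← norm_neg]
    ring_nf
end
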